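/- arXiv:2503.22439 — 2 statements merged into one kernel-verified Lean document; each statement's English description precedes it below -/
import Mathlib

section
/- Let 2 < p < ∞. There exist constants M > 0 and ν > 0, depending only on p, q, α₁, α₂, β₁, γ₁, μ₁ (and not on the solution), such that every classical solution of system (S) with a ≡ 1 satisfies, for all t ≥ 0: E_p(t) ≤ M e^{−νt} E_p(0) and max_{x∈[0,1]} |u(t,x) − u_*|^p ≤ M E_p(0) e^{−νt}. -/
open Set MeasureTheory

/-- A classical solution of system (S): a wave equation with localized in-domain damping and
Wentzell (dynamic) boundary conditions. -/
structure ClassicalSolutionS (a q : ℝ → ℝ) (α₁ α₂ β₁ γ₁ μ₁ : ℝ) where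
  u : ℝ → ℝ → ℝ
  ut : ℝ → ℝ → ℝ
  ux : ℝ → ℝ → ℝ
  utt : ℝ → ℝ → ℝ
  dAux : ℝ → ℝ → ℝ
  η₁ : ℝ → ℝ
  η₂ : ℝ → ℝ
  ζ₁ : ℝ → ℝ
  hu_t : ∀ t ∈ Ici (0:ℝ), ∀ x ∈ Icc (0:ℝ) 1, HasDerivAt (fun s => u s x) (ut t x) t
  hu_x : ∀ t ∈ Ici (0:ℝ), ∀ x ∈ Icc (0:ℝ) 1, HasDerivAt (fun y => u t y) (ux t x) x
  hut_C1 : ContDiffOn ℝ 1 (fun p : ℝ × ℝ => ut p.1 p.2) (Ici (0:ℝ) ×ˢ Icc (0:ℝ) 1)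
  hux_C1 : ContDiffOn ℝ 1 (fun p : ℝ × ℝ => ux p.1 p.2) (Ici (0:ℝ) ×ˢ Icc (0:ℝ) 1)
  hu_tt : ∀ t ∈ Ici (0:ℝ), ∀ x ∈ Icc (0:ℝ) 1, HasDerivAt (fun s => ut s x) (utt t x) t
  haux_lip : ∀ t ∈ Ici (0:ℝ),
      ∃ K : NNReal, LipschitzOnWith K (fun x => a x * ux t x) (Icc (0:ℝ) 1)
  haux : ∀ t ∈ Ici (0:ℝ), ∀ᵐ x ∂(volume.restrict (Ioo (0:ℝ) 1)),
      HasDerivAt (fun y => a y * ux t y) (dAux t x) x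
  hPDE : ∀ t ∈ Ici (0:ℝ), ∀ᵐ x ∂(volume.restrict (Ioo (0:ℝ) 1)),
      utt t x - dAux t x = - q x * ut t x
  hbc1 : ∀ t ∈ Ici (0:ℝ), ut t 1 = η₁ t
  hbc0 : ∀ t ∈ Ici (0:ℝ), ut t 0 = ζ₁ t
  hη₁C1 : ContDiffOn ℝ 1 η₁ (Ici (0:ℝ))
  hη₂C1 : ContDiffOn ℝ 1 η₂ (Ici (0:ℝ))
  hζ₁C1 : ContDiffOn ℝ 1 ζ₁ (Ici (0:ℝ))
  hode1 : ∀ t ∈ Ici (0:ℝ), HasDerivAt η₁ (-α₁ * η₁ t - α₂ * η₂ t - β₁ * ux t 1) t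
  hode2 : ∀ t ∈ Ici (0:ℝ), HasDerivAt η₂ (η₁ t) t
  hode3 : ∀ t ∈ Ici (0:ℝ), HasDerivAt ζ₁ (-γ₁ * ζ₁ t + μ₁ * ux t 0) t

/-- Assumption (A2): `q` is bounded measurable, nonnegative a.e., and bounded below by
`q_min > 0` (and above by `q_max`) a.e. on a nonempty open subinterval `ω = (c,d) ⊆ (0,1)`. -/
def AssumptionA2 (q : ℝ → ℝ) (c d q_min q_max : ℝ) : Prop :=
  Measurable q ∧ (∃ Q : ℝ, ∀ x ∈ Icc (0:ℝ) 1, |q x| ≤ Q) ∧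
    (∀ᵐ x ∂(volume.restrict (Ioo (0:ℝ) 1)), 0 ≤ q x) ∧
    0 ≤ c ∧ c < d ∧ d ≤ 1 ∧ 0 < q_min ∧ q_min ≤ q_max ∧
    ∀ᵐ x ∂(volume.restrict (Ioo c d)), q_min ≤ q x ∧ q x ≤ q_max

/-- The `L^p` energy of a classical solution of system (S) with `a ≡ 1`, for `p` real. -/
noncomputable def energyLp {q : ℝ → ℝ} {α₁ α₂ β₁ γ₁ μ₁ : ℝ} (p : ℝ)
    (sol : ClassicalSolutionS (fun _ => 1) q α₁ α₂ β₁ γ₁ μ₁) (t : ℝ) : ℝ :=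
  (1/p) * (∫ x in (0:ℝ)..1, (|sol.ut t x| ^ p + |sol.ux t x| ^ p))
    + (1 / (p * β₁)) * |sol.η₁ t| ^ p
    + (α₂ / (p * β₁)) * |sol.η₂ t| ^ p
    + (1 / (p * μ₁)) * |sol.ζ₁ t| ^ p

/-- The derivative of `s ↦ |s| ^ p / p`. -/
noncomputable def signedPow (p s : ℝ) : ℝ := |s| ^ (p - 2) * s

lemma continuous_abs_rpow {p : ℝ} (hp : 0 ≤ p) : Continuous fun s : ℝ => |s| ^ p :=
  continuous_abs.rpow_const fun _ => Or.inr hp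

lemma continuous_signedPow {p : ℝ} (hp : 2 ≤ p) : Continuous (signedPow p) :=
  (continuous_abs_rpow (by linarith)).mul continuous_id

lemma abs_signedPow {p : ℝ} (hp : 2 ≤ p) (s : ℝ) : |signedPow p s| = |s| ^ (p - 1) := by
  rcases eq_or_ne s 0 with rfl | hs
  · simp [signedPow, Real.zero_rpow (show p - 1 ≠ 0 by linarith)]
  · rw [signedPow, abs_mul, abs_of_nonneg (by positivity : 0 ≤ |s| ^ (p - 2)),
      show p - 1 = (p - 2) + 1 by ring, Real.rpow_add_one (abs_pos.2 hs).ne']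

lemma mul_signedPow {p : ℝ} (hp : 2 ≤ p) (s : ℝ) : s * signedPow p s = |s| ^ p := by
  rcases eq_or_ne s 0 with rfl | hs
  · simp [Real.zero_rpow (show p ≠ 0 by linarith)]
  · have h : |s| ^ p = |s| ^ (p - 2) * |s| * |s| := by
      rw [← Real.rpow_add_one (abs_pos.2 hs).ne', ← Real.rpow_add_one (abs_pos.2 hs).ne']
      ring_nf
    rw [h, signedPow]
    linear_combination (-|s| ^ (p - 2)) * abs_mul_abs_self s

lemma signedPow_mul {p t : ℝ} (ht : 0 < t) (s : ℝ) :
    signedPow p (t * s) = t ^ (p - 1) * signedPow p s := by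
  rw [signedPow, signedPow, abs_mul, abs_of_pos ht, Real.mul_rpow ht.le (abs_nonneg s),
    show p - 1 = (p - 2) + 1 by ring, Real.rpow_add_one ht.ne']
  ring

lemma abs_mul_rpow {p t : ℝ} (ht : 0 < t) (s : ℝ) : |t * s| ^ p = t ^ p * |s| ^ p := by
  rw [abs_mul, abs_of_pos ht, Real.mul_rpow ht.le (abs_nonneg s)]

lemma hasDerivAt_abs_rpow_signedPow {p : ℝ} (hp : 2 ≤ p) (s : ℝ) :
    HasDerivAt (fun s => |s| ^ p) (p * signedPow p s) s := by
  have := hasDerivAt_abs_rpow s (show 1 < p by linarith)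
  rwa [mul_assoc] at this

lemma hasDerivAt_signedPow {p : ℝ} (hp : 2 ≤ p) (s : ℝ) :
    HasDerivAt (signedPow p) ((p - 1) * |s| ^ (p - 2)) s := by
  rcases eq_or_ne s 0 with rfl | hs
  · have h0 : (p - 1) * |(0:ℝ)| ^ (p - 2) = |(0:ℝ)| ^ (p - 2) := by
      rcases eq_or_lt_of_le hp with rfl | h
      · norm_num
      · simp [Real.zero_rpow (show p - 2 ≠ 0 by linarith)]
    rw [h0, hasDerivAt_iff_tendsto_slope]
    refine (((continuous_abs_rpow (show 0 ≤ p - 2 by linarith)).tendsto 0).mono_left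
      nhdsWithin_le_nhds).congr' ?_
    filter_upwards [self_mem_nhdsWithin] with y hy
    have hy : y ≠ 0 := hy
    simp [slope_def_field, signedPow, hy]
  · have h1 : HasDerivAt (fun s : ℝ => |s| ^ (p - 2))
        (SignType.sign s * (p - 2) * |s| ^ (p - 2 - 1)) s :=
      (hasDerivAt_abs hs).rpow_const (Or.inl (abs_pos.2 hs).ne')
    refine (h1.mul (hasDerivAt_id s)).congr_deriv ?_
    have h2 : |s| ^ (p - 2) = |s| ^ (p - 2 - 1) * |s| := by
      rw [← Real.rpow_add_one (abs_pos.2 hs).ne']; ring_nf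
    have h3 : (SignType.sign s : ℝ) * s = |s| := by simp
    simp only [id, h2]
    linear_combination ((p - 2) * |s| ^ (p - 2 - 1)) * h3

lemma strictMono_signedPow {p : ℝ} (hp : 2 ≤ p) : StrictMono (signedPow p) := by
  refine strictMono_of_odd_strictMonoOn_nonneg (fun x => by simp [signedPow]) ?_
  intro a ha b hb hab
  have key : ∀ s : ℝ, 0 ≤ s → signedPow p s = s ^ (p - 1) := fun s hs => by
    have h0 : 0 ≤ signedPow p s := mul_nonneg (by positivity) hs
    rw [← abs_of_nonneg h0, abs_signedPow hp, abs_of_nonneg hs]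
  rw [key a ha, key b hb]
  exact Real.rpow_lt_rpow ha hab (by linarith)

/-- The coefficient of the damping in the dissipation of `|r| ^ p + |s| ^ p`. -/
noncomputable def dissip (p r s : ℝ) : ℝ := (signedPow p r - signedPow p s) * (r - s)

lemma dissip_nonneg {p : ℝ} (hp : 2 ≤ p) (r s : ℝ) : 0 ≤ dissip p r s := by
  rcases le_total r s with h | h
  · exact mul_nonneg_of_nonpos_of_nonpos (sub_nonpos.2 ((strictMono_signedPow hp).monotone h))
      (sub_nonpos.2 h)
  · exact mul_nonneg (sub_nonneg.2 ((strictMono_signedPow hp).monotone h)) (sub_nonneg.2 h)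

lemma eq_of_dissip_eq_zero {p r s : ℝ} (hp : 2 ≤ p) (h : dissip p r s = 0) : r = s := by
  rcases mul_eq_zero.1 h with h | h
  · exact (strictMono_signedPow hp).injective (sub_eq_zero.1 h)
  · exact sub_eq_zero.1 h

/-- A continuous positively homogeneous function which is negative on the zero set of a nonnegative
one of the same degree is dominated by it. -/
lemma exists_le_mul_of_homogeneous {p : ℝ} (hp : 0 < p) {k g : ℝ → ℝ → ℝ}
    (hk : Continuous fun z : ℝ × ℝ => k z.1 z.2) (hg : Continuous fun z : ℝ × ℝ => g z.1 z.2)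
    (hkh : ∀ t > 0, ∀ a b, k (t * a) (t * b) = t ^ p * k a b)
    (hgh : ∀ t > 0, ∀ a b, g (t * a) (t * b) = t ^ p * g a b)
    (hg0 : ∀ a b, 0 ≤ g a b) (hneg : ∀ a b, (a, b) ≠ (0, 0) → g a b = 0 → k a b < 0) :
    ∃ C ≥ 0, ∀ a b, k a b ≤ C * g a b := by
  have zero : k 0 0 = 0 := by
    have h := hkh 2 (by norm_num) 0 0
    have h2 : (1:ℝ) < 2 ^ p := Real.one_lt_rpow (by norm_num) hp
    simp only [mul_zero] at h
    nlinarith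
  let K : Set (ℝ × ℝ) := Metric.sphere 0 1 ∩ {z | 0 ≤ k z.1 z.2}
  have hK : IsCompact K := (isCompact_sphere _ _).inter_right (isClosed_le continuous_const hk)
  have hpos : ∀ z ∈ K, 0 < g z.1 z.2 := by
    rintro ⟨a, b⟩ ⟨h1, h2⟩
    refine lt_of_le_of_ne (hg0 _ _) fun h => ?_
    refine absurd (hneg a b ?_ h.symm) (not_lt.2 h2)
    rintro h0
    rw [h0] at h1
    simp at h1
  obtain ⟨C, hC0, hC⟩ : ∃ C ≥ 0, ∀ z ∈ K, k z.1 z.2 ≤ C * g z.1 z.2 := by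
    obtain ⟨C, hC⟩ := (hK.image_of_continuousOn (f := fun z : ℝ × ℝ => k z.1 z.2 / g z.1 z.2)
      (hk.continuousOn.div hg.continuousOn fun z hz => (hpos z hz).ne')).bddAbove
    refine ⟨max C 0, le_max_right _ _, fun z hz => ?_⟩
    have := hC (mem_image_of_mem _ hz)
    rw [← div_le_iff₀ (hpos z hz)]
    exact this.trans (le_max_left _ _)
  refine ⟨C, hC0, fun a b => ?_⟩
  rcases eq_or_ne (a, b) (0, 0) with h | h
  · obtain ⟨rfl, rfl⟩ := Prod.mk.inj h
    rw [zero]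
    exact mul_nonneg hC0 (hg0 _ _)
  · have hn : 0 < ‖(a, b)‖ := norm_pos_iff.2 h
    set n := ‖(a, b)‖
    have hunit : ∀ c : ℝ, c = n * (n⁻¹ * c) := fun c => by field_simp
    have key : k (n⁻¹ * a) (n⁻¹ * b) ≤ C * g (n⁻¹ * a) (n⁻¹ * b) := by
      by_cases hs : 0 ≤ k (n⁻¹ * a) (n⁻¹ * b)
      · refine hC (n⁻¹ * a, n⁻¹ * b) ⟨?_, hs⟩
        have : (n⁻¹ * a, n⁻¹ * b) = n⁻¹ • (a, b) := rfl
        rw [mem_sphere_zero_iff_norm, this, norm_smul, norm_inv, norm_norm]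
        exact inv_mul_cancel₀ hn.ne'
      · exact (not_le.1 hs).le.trans (mul_nonneg hC0 (hg0 _ _))
    rw [hunit a, hunit b, hkh n hn, hgh n hn]
    have := Real.rpow_nonneg hn.le p
    nlinarith

/-- Young's inequality with a small parameter. -/
lemma exists_rpow_mul_le {p : ℝ} (hp : 2 ≤ p) {δ : ℝ} (hδ : 0 < δ) :
    ∃ C ≥ 0, ∀ a b : ℝ, |a| ^ (p - 1) * |b| ≤ δ * |a| ^ p + C * |b| ^ p := by
  have hp0 : p ≠ 0 := by linarith
  obtain ⟨C, hC, h⟩ := exists_le_mul_of_homogeneous (p := p) (by linarith)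
    (k := fun a b => |a| ^ (p - 1) * |b| - δ * |a| ^ p) (g := fun _ b => |b| ^ p)
    ((((continuous_abs_rpow (by linarith)).comp continuous_fst).mul
      (continuous_abs.comp continuous_snd)).sub
      (continuous_const.mul ((continuous_abs_rpow (by linarith)).comp continuous_fst)))
    ((continuous_abs_rpow (by linarith)).comp continuous_snd)
    (fun t ht a b => by
      simp only [abs_mul, abs_of_pos ht, mul_sub]
      rw [Real.mul_rpow ht.le (abs_nonneg _), show t ^ p = t ^ (p - 1) * t by
        rw [← Real.rpow_add_one ht.ne']; ring_nf, Real.mul_rpow ht.le (abs_nonneg _),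
        show t ^ p = t ^ (p - 1) * t by rw [← Real.rpow_add_one ht.ne']; ring_nf]
      ring)
    (fun t ht a b => abs_mul_rpow ht b) (fun a b => by positivity)
    (fun a b hab h => by
      have hb : b = 0 := by simpa [Real.rpow_eq_zero_iff_of_nonneg, hp0] using h
      subst hb
      have ha : a ≠ 0 := fun h => hab (by rw [h])
      have : 0 < |a| ^ p := Real.rpow_pos_of_pos (abs_pos.2 ha) _
      simp only [abs_zero, mul_zero, zero_sub]
      nlinarith)
  exact ⟨C, hC, fun a b => by have := h a b; linarith⟩

lemma exists_abs_add_rpow_le {p : ℝ} (hp : 2 ≤ p) (N : ℝ) :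
    ∃ C ≥ 0, ∀ a b : ℝ, (N - 1) * |a + 2 * b| ^ p - (N + 1) * |a| ^ p ≤ C * |b| ^ p := by
  have hp0 : p ≠ 0 := by linarith
  have hc := continuous_abs_rpow (show 0 ≤ p by linarith)
  refine exists_le_mul_of_homogeneous (p := p) (by linarith)
    (k := fun a b => (N - 1) * |a + 2 * b| ^ p - (N + 1) * |a| ^ p) (g := fun _ b => |b| ^ p)
    ((continuous_const.mul (hc.comp (continuous_fst.add (continuous_const.mul continuous_snd)))).sub
      (continuous_const.mul (hc.comp continuous_fst))) (hc.comp continuous_snd)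
    (fun t ht a b => ?_) (fun t ht a b => abs_mul_rpow ht b) (fun a b => by positivity)
    (fun a b hab h => ?_)
  · simp only [show t * a + 2 * (t * b) = t * (a + 2 * b) by ring, abs_mul_rpow ht]
    ring
  · have hb : b = 0 := by simpa [Real.rpow_eq_zero_iff_of_nonneg, hp0] using h
    subst hb
    have ha : a ≠ 0 := fun h => hab (by rw [h])
    have : 0 < |a| ^ p := Real.rpow_pos_of_pos (abs_pos.2 ha) _
    simp only [mul_zero, add_zero]
    nlinarith

lemma continuous_dissip {p : ℝ} (hp : 2 ≤ p) :
    Continuous fun z : ℝ × ℝ => dissip p z.1 z.2 := by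
  have := continuous_signedPow hp
  unfold dissip
  fun_prop

lemma rpow_eq_rpow_sub_one_mul {p t : ℝ} (ht : 0 < t) : t ^ p = t ^ (p - 1) * t := by
  rw [← Real.rpow_add_one ht.ne', sub_add_cancel]

lemma dissip_mul {p t : ℝ} (ht : 0 < t) (r s : ℝ) :
    dissip p (t * r) (t * s) = t ^ p * dissip p r s := by
  rw [dissip, dissip, signedPow_mul ht, signedPow_mul ht, rpow_eq_rpow_sub_one_mul (p := p) ht]
  ring

lemma exists_cross_le_dissip {p : ℝ} (hp : 2 ≤ p) :
    ∃ C ≥ 0, ∀ r s : ℝ,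
      4 * (|r| ^ p + |s| ^ p) - 9 * (s * signedPow p r) ≤ C * dissip p r s := by
  have hc := continuous_abs_rpow (show 0 ≤ p by linarith)
  have hf := continuous_signedPow hp
  refine exists_le_mul_of_homogeneous (p := p) (by linarith)
    (k := fun r s => 4 * (|r| ^ p + |s| ^ p) - 9 * (s * signedPow p r)) (g := dissip p)
    ?_ (continuous_dissip hp) (fun t ht r s => ?_) (fun t ht r s => dissip_mul ht r s)
    (dissip_nonneg hp) (fun r s hrs h => ?_)
  · exact (continuous_const.mul ((hc.comp continuous_fst).add (hc.comp continuous_snd))).sub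
      (continuous_const.mul (continuous_snd.mul (hf.comp continuous_fst)))
  · simp only [abs_mul_rpow ht, signedPow_mul ht]
    rw [rpow_eq_rpow_sub_one_mul (p := p) ht]
    ring
  · obtain rfl := eq_of_dissip_eq_zero hp h
    have hr : r ≠ 0 := fun h => hrs (by rw [h])
    have : 0 < |r| ^ p := Real.rpow_pos_of_pos (abs_pos.2 hr) _
    simp only [mul_signedPow hp]
    linarith

lemma exists_abs_signedPow_add_le_dissip {p : ℝ} (hp : 2 ≤ p) {δ : ℝ} (hδ : 0 < δ) :
    ∃ C ≥ 0, ∀ r s : ℝ, |signedPow p r + signedPow p s| * |r - s| ≤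
      δ * (|r| ^ p + |s| ^ p) + C * dissip p r s := by
  have hc := continuous_abs_rpow (show 0 ≤ p by linarith)
  have hf := continuous_signedPow hp
  obtain ⟨C, hC, h⟩ := exists_le_mul_of_homogeneous (p := p) (by linarith)
    (k := fun r s => |signedPow p r + signedPow p s| * |r - s| - δ * (|r| ^ p + |s| ^ p))
    (g := dissip p)
    ((((hf.comp continuous_fst).add (hf.comp continuous_snd)).abs.mul
      (continuous_fst.sub continuous_snd).abs).sub
      (continuous_const.mul ((hc.comp continuous_fst).add (hc.comp continuous_snd))))
    (continuous_dissip hp) (fun t ht r s => by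
      rw [abs_mul_rpow ht, abs_mul_rpow ht, signedPow_mul ht, signedPow_mul ht, ← mul_add,
        ← mul_sub, abs_mul, abs_mul, abs_of_pos ht, abs_of_pos (Real.rpow_pos_of_pos ht (p - 1))]
      rw [rpow_eq_rpow_sub_one_mul (p := p) ht]
      ring) (fun t ht r s => dissip_mul ht r s)
    (dissip_nonneg hp) (fun r s hrs h => by
      obtain rfl := eq_of_dissip_eq_zero hp h
      have hr : r ≠ 0 := fun h => hrs (by rw [h])
      have : 0 < |r| ^ p := Real.rpow_pos_of_pos (abs_pos.2 hr) _
      simp only [sub_self, abs_zero, mul_zero, zero_sub]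
      nlinarith)
  exact ⟨C, hC, fun r s => by have := h r s; linarith⟩

lemma exists_sqrt_mul_le {p : ℝ} (hp : 2 ≤ p) {δ B K : ℝ} (hδ : 0 < δ) (hB : 0 ≤ B)
    (hK : 0 ≤ K) : ∃ C ≥ 0, ∀ a v φ : ℝ, 0 ≤ φ → φ ≤ B →
      K * (√φ * (|v| * |a| ^ (p - 1))) ≤ δ * |a| ^ p + C * (φ * |v| ^ p) := by
  obtain ⟨C, hC, h⟩ := exists_rpow_mul_le hp hδ
  refine ⟨C * (K ^ p * B ^ (p / 2 - 1)), by positivity, fun a v φ hφ hφB => ?_⟩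
  have h1 := h a (K * √φ * v)
  have h2 : |K * √φ * v| ^ p ≤ K ^ p * B ^ (p / 2 - 1) * (φ * |v| ^ p) := by
    rw [abs_mul, abs_mul, abs_of_nonneg hK, abs_of_nonneg (Real.sqrt_nonneg φ),
      Real.mul_rpow (by positivity) (abs_nonneg v), Real.mul_rpow hK (Real.sqrt_nonneg φ),
      Real.sqrt_eq_rpow, ← Real.rpow_mul hφ, show 1 / 2 * p = 1 + (p / 2 - 1) by ring,
      Real.rpow_add_of_nonneg hφ (by norm_num) (by linarith), Real.rpow_one]
    have : φ ^ (p / 2 - 1) ≤ B ^ (p / 2 - 1) := Real.rpow_le_rpow hφ hφB (by linarith)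
    calc K ^ p * (φ * φ ^ (p / 2 - 1)) * |v| ^ p ≤ K ^ p * (φ * B ^ (p / 2 - 1)) * |v| ^ p := by
          gcongr
      _ = _ := by ring
  have h3 : |K * √φ * v| = K * √φ * |v| := by
    rw [abs_mul, abs_of_nonneg (by positivity)]
  rw [h3] at h1
  calc K * (√φ * (|v| * |a| ^ (p - 1))) = |a| ^ (p - 1) * (K * √φ * |v|) := by ring
    _ ≤ _ := h1
    _ ≤ δ * |a| ^ p + C * (K ^ p * B ^ (p / 2 - 1) * (φ * |v| ^ p)) := by
        rw [← h3]; gcongr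
    _ = _ := by ring

/-- The integrand of the Lyapunov functional, as a function of the Riemann invariants `r`, `s`, the
displacement `v` and the weights. -/
noncomputable def lyapDensity (p N h φ r s v : ℝ) : ℝ :=
  (N + h) * |r| ^ p + (N - h) * |s| ^ p + 9 * (φ * (v * signedPow p r))

lemma exists_lyapDensity_bounds {p : ℝ} (hp : 2 ≤ p) {B : ℝ} (hB : 0 ≤ B) :
    ∃ C ≥ 0, ∀ N ≥ 5, ∀ r s v φ h : ℝ, 0 ≤ φ → φ ≤ B → |h| ≤ 3 →
      |r| ^ p + |s| ^ p - C * (φ * |v| ^ p) ≤ lyapDensity p N h φ r s v ∧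
      lyapDensity p N h φ r s v ≤ (N + 4) * (|r| ^ p + |s| ^ p) + C * (φ * |v| ^ p) := by
  obtain ⟨C, hC, H⟩ := exists_sqrt_mul_le hp one_pos hB (show 0 ≤ 9 * √B by positivity)
  refine ⟨C, hC, fun N hN r s v φ h hφ hφB hh => ?_⟩
  have h1 := H r v φ hφ hφB
  have h2 : |9 * (φ * (v * signedPow p r))| ≤ 9 * √B * (√φ * (|v| * |r| ^ (p - 1))) := by
    rw [abs_mul, abs_mul, abs_mul, abs_signedPow hp, abs_of_nonneg hφ,
      abs_of_pos (by norm_num : (0:ℝ) < 9)]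
    have : φ ≤ √B * √φ := by
      calc φ = √φ * √φ := (Real.mul_self_sqrt hφ).symm
        _ ≤ √B * √φ := by gcongr
    calc 9 * (φ * (|v| * |r| ^ (p - 1))) ≤ 9 * (√B * √φ * (|v| * |r| ^ (p - 1))) := by gcongr
      _ = _ := by ring
  have h3 := abs_le.1 (h2.trans h1)
  have h4 := abs_le.1 hh
  have hr : 0 ≤ |r| ^ p := by positivity
  have hs : 0 ≤ |s| ^ p := by positivity
  unfold lyapDensity
  constructor <;> nlinarith

/-- The pointwise inequality behind the decay of the Lyapunov functional. -/
lemma exists_lyapDensity_decay {p : ℝ} (hp : 2 ≤ p) {Q κ B A : ℝ} (hQ : 0 ≤ Q) (hκ : 0 ≤ κ)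
    (hB : 0 ≤ B) (hA : 0 ≤ A) :
    ∃ N ≥ 5, ∃ C ≥ 0, ∀ r s v q φ dφ h : ℝ, 0 ≤ q → q ≤ Q → 0 ≤ φ → φ ≤ B → φ ≤ κ * q →
      |dφ| ≤ A * √φ → |h| ≤ 3 →
      -(1 - 3 * φ) * (|r| ^ p + |s| ^ p)
        - p * N * q * (signedPow p r - signedPow p s) * ((r - s) / 2)
        - p * h * q * (signedPow p r + signedPow p s) * ((r - s) / 2)
        + 9 * (-(φ * (s * signedPow p r)) - dφ * (v * signedPow p r)
          - φ * (v * ((p - 1) * |r| ^ (p - 2) * (q * ((r - s) / 2)))))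
      ≤ -(1 / 2) * (|r| ^ p + |s| ^ p) + C * (φ * |v| ^ p) := by
  obtain ⟨C₁, hC₁, H₁⟩ := exists_cross_le_dissip hp
  obtain ⟨C₂, hC₂, H₂⟩ := exists_abs_signedPow_add_le_dissip hp
    (show 0 < 1 / (6 * p * (Q + 1)) by positivity)
  obtain ⟨C₃, hC₃, H₃⟩ := exists_sqrt_mul_le hp (show (0:ℝ) < 1 / 4 by norm_num) hB
    (show 0 ≤ 9 * (A + √B * Q * (p - 1)) from
      mul_nonneg (by norm_num) (add_nonneg hA (mul_nonneg (by positivity) (by linarith))))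
  refine ⟨5 + 2 * κ * C₁ / p + 3 * C₂, ?_, C₃, hC₃, ?_⟩
  · have : 0 ≤ 2 * κ * C₁ / p := by positivity
    linarith
  intro r s v q φ dφ h hq hqQ hφ hφB hφq hdφ hh
  set e := |r| ^ p + |s| ^ p with he
  have he0 : 0 ≤ e := by positivity
  have hD := dissip_nonneg hp r s
  have hp0 : 0 < p := by linarith
  have i1 : φ * (3 * e - 9 * (s * signedPow p r)) ≤ κ * C₁ * (q * dissip p r s) := by
    calc φ * (3 * e - 9 * (s * signedPow p r)) ≤ φ * (C₁ * dissip p r s) := by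
          gcongr
          linarith [H₁ r s]
      _ ≤ (κ * q) * (C₁ * dissip p r s) := by gcongr
      _ = _ := by ring
  have i2 : -(p * h * q * (signedPow p r + signedPow p s) * ((r - s) / 2)) ≤
      e / 4 + 3 * p / 2 * C₂ * (q * dissip p r s) := by
    calc -(p * h * q * (signedPow p r + signedPow p s) * ((r - s) / 2))
        ≤ |p * h * q * (signedPow p r + signedPow p s) * ((r - s) / 2)| := neg_le_abs _
      _ = p / 2 * (|h| * (q * (|signedPow p r + signedPow p s| * |r - s|))) := by
          simp only [abs_mul, abs_div, abs_of_pos hp0, abs_of_nonneg hq, abs_two]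
          ring
      _ ≤ p / 2 * (3 * (q * (1 / (6 * p * (Q + 1)) * e + C₂ * dissip p r s))) := by
          gcongr
          exact H₂ r s
      _ = q / (Q + 1) * (e / 4) + 3 * p / 2 * C₂ * (q * dissip p r s) := by
          field_simp
          ring
      _ ≤ 1 * (e / 4) + 3 * p / 2 * C₂ * (q * dissip p r s) := by
          gcongr
          rw [div_le_one (by linarith)]
          linarith
      _ = _ := by ring
  have i3 : 9 * (- dφ * (v * signedPow p r)
        - φ * (v * ((p - 1) * |r| ^ (p - 2) * (q * ((r - s) / 2))))) ≤
      e / 4 + C₃ * (φ * |v| ^ p) := by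
    set m := max |r| |s| with hm
    have hm0 : 0 ≤ m := (abs_nonneg r).trans (le_max_left _ _)
    have hmp : |m| ^ p ≤ e := by
      rw [abs_of_nonneg hm0]
      rcases max_choice |r| |s| with h | h <;> rw [hm, h, he]
      · linarith [show 0 ≤ |s| ^ p by positivity]
      · linarith [show 0 ≤ |r| ^ p by positivity]
    have hr1 : |r| ^ (p - 1) ≤ m ^ (p - 1) :=
      Real.rpow_le_rpow (abs_nonneg r) (le_max_left _ _) (by linarith)
    have hr2 : |r| ^ (p - 2) * (|r - s| / 2) ≤ m ^ (p - 1) := by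
      have a1 : |r| ^ (p - 2) ≤ m ^ (p - 2) :=
        Real.rpow_le_rpow (abs_nonneg r) (le_max_left _ _) (by linarith)
      have a2 : |r - s| / 2 ≤ m := by
        have := abs_sub r s
        have := le_max_left |r| |s|
        have := le_max_right |r| |s|
        linarith
      have a3 : m ^ (p - 1) = m ^ (p - 2) * m := by
        rw [show p - 1 = p - 2 + 1 by ring, Real.rpow_add_of_nonneg hm0 (by linarith) one_pos.le,
          Real.rpow_one]
      rw [a3]
      gcongr
    have hφs : φ ≤ √B * √φ := by
      calc φ = √φ * √φ := (Real.mul_self_sqrt hφ).symm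
        _ ≤ √B * √φ := by gcongr
    have b1 : - dφ * (v * signedPow p r) ≤ A * √φ * (|v| * m ^ (p - 1)) := by
      calc - dφ * (v * signedPow p r) ≤ |- dφ * (v * signedPow p r)| := le_abs_self _
        _ = |dφ| * (|v| * |r| ^ (p - 1)) := by rw [abs_mul, abs_neg, abs_mul, abs_signedPow hp]
        _ ≤ _ := by gcongr
    have b2 : -(φ * (v * ((p - 1) * |r| ^ (p - 2) * (q * ((r - s) / 2))))) ≤
        √B * √φ * (|v| * ((p - 1) * (Q * m ^ (p - 1)))) := by
      have hp1 : 0 ≤ p - 1 := by linarith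
      calc -(φ * (v * ((p - 1) * |r| ^ (p - 2) * (q * ((r - s) / 2)))))
          ≤ |φ * (v * ((p - 1) * |r| ^ (p - 2) * (q * ((r - s) / 2))))| := neg_le_abs _
        _ = φ * (|v| * ((p - 1) * (q * (|r| ^ (p - 2) * (|r - s| / 2))))) := by
            simp only [abs_mul, abs_div, abs_of_nonneg hφ, abs_of_nonneg hq, abs_two,
              abs_of_nonneg hp1, abs_of_nonneg (show 0 ≤ |r| ^ (p - 2) by positivity)]
            ring
        _ ≤ _ := by gcongr
    have b3 := H₃ m v φ hφ hφB
    rw [abs_of_nonneg hm0] at b3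
    rw [abs_of_nonneg hm0] at hmp
    calc _ ≤ 9 * (A + √B * Q * (p - 1)) * (√φ * (|v| * m ^ (p - 1))) := by linarith
      _ ≤ _ := by linarith
  have i4 : p * (5 + 2 * κ * C₁ / p + 3 * C₂) * q * (signedPow p r - signedPow p s) * ((r - s) / 2)
      = 5 * p / 2 * (q * dissip p r s) + κ * C₁ * (q * dissip p r s)
        + 3 * p / 2 * C₂ * (q * dissip p r s) := by
    unfold dissip
    field_simp
  have i5 : 0 ≤ 5 * p / 2 * (q * dissip p r s) := by positivity
  rw [i4]
  linarith

section Calculus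
open Function

lemma hasDerivAt_integral_unit {F F' : ℝ → ℝ → ℝ} (hF : Continuous (uncurry F))
    (hF' : Continuous (uncurry F'))
    (hd : ∀ t > 0, ∀ x ∈ Ioo (0:ℝ) 1, HasDerivAt (fun s => F s x) (F' t x) t)
    {a b t : ℝ} (ha : a ∈ Icc (0:ℝ) 1) (hb : b ∈ Icc (0:ℝ) 1) (ht : 0 < t) :
    HasDerivAt (fun s => ∫ x in a..b, F s x) (∫ x in a..b, F' t x) t := by
  have hsub : uIoc a b ⊆ Ioc 0 1 := by
    intro x hx
    rw [mem_uIoc] at hx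
    rcases hx with hx | hx
    · exact ⟨ha.1.trans_lt hx.1, hx.2.trans hb.2⟩
    · exact ⟨hb.1.trans_lt hx.1, hx.2.trans ha.2⟩
  obtain ⟨M, hM⟩ := ((isCompact_Icc (a := t / 2) (b := 2 * t)).prod
    (isCompact_Icc (a := (0:ℝ)) (b := 1))).exists_bound_of_continuousOn hF'.continuousOn
  refine (intervalIntegral.hasDerivAt_integral_of_dominated_loc_of_deriv_le (μ := volume)
    (s := Icc (t / 2) (2 * t)) (bound := fun _ => M) (Icc_mem_nhds (by linarith) (by linarith))
    (Filter.Eventually.of_forall fun s => (?_ : Continuous (F s)).aestronglyMeasurable)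
    ((?_ : Continuous (F t)).intervalIntegrable _ _)
    (?_ : Continuous (F' t)).aestronglyMeasurable ?_ (by simp) ?_).2
  · fun_prop
  · fun_prop
  · fun_prop
  · refine Filter.Eventually.of_forall fun x hx s hs => hM (s, x) ⟨hs, ?_⟩
    exact Ioc_subset_Icc_self (hsub hx)
  · filter_upwards [Measure.ae_ne volume (1:ℝ)] with x hx1 hx s hs
    exact hd s (by linarith [hs.1]) x ⟨(hsub hx).1, lt_of_le_of_ne (hsub hx).2 hx1⟩

lemma integral_unit_eq_sub {G G' : ℝ → ℝ} (hG : Continuous G) (hG' : Continuous G')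
    (hd : ∀ x ∈ Ioo (0:ℝ) 1, HasDerivAt G (G' x) x) :
    ∫ x in (0:ℝ)..1, G' x = G 1 - G 0 :=
  intervalIntegral.integral_eq_sub_of_hasDerivAt_of_le zero_le_one hG.continuousOn hd
    (hG'.intervalIntegrable _ _)

lemma integral_unit_mono_ae {f g : ℝ → ℝ} (hf : Continuous f) (hg : Continuous g)
    (h : ∀ᵐ x ∂(volume.restrict (Ioo (0:ℝ) 1)), f x ≤ g x) :
    ∫ x in (0:ℝ)..1, f x ≤ ∫ x in (0:ℝ)..1, g x := by
  refine intervalIntegral.integral_mono_ae_restrict zero_le_one (hf.intervalIntegrable _ _)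
    (hg.intervalIntegrable _ _) ?_
  rwa [← Measure.restrict_congr_set (Ioo_ae_eq_Icc (μ := volume) (a := (0:ℝ)) (b := 1))]

lemma integral_unit_mono {f g : ℝ → ℝ} (hf : Continuous f) (hg : Continuous g)
    (h : ∀ x ∈ Icc (0:ℝ) 1, f x ≤ g x) :
    ∫ x in (0:ℝ)..1, f x ≤ ∫ x in (0:ℝ)..1, g x :=
  intervalIntegral.integral_mono_on zero_le_one (hf.intervalIntegrable _ _)
    (hg.intervalIntegrable _ _) h

lemma sq_integral_weight_mul_le {w f : ℝ → ℝ} (hw : Continuous w) (hf : Continuous f)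
    (hw0 : ∀ x, 0 ≤ w x) (hw1 : ∫ x in (0:ℝ)..1, w x = 1) :
    (∫ x in (0:ℝ)..1, w x * f x) ^ 2 ≤ ∫ x in (0:ℝ)..1, w x * f x ^ 2 := by
  set m := ∫ x in (0:ℝ)..1, w x * f x with hm
  have h0 : 0 ≤ ∫ x in (0:ℝ)..1, w x * (f x - m) ^ 2 :=
    intervalIntegral.integral_nonneg zero_le_one fun x _ => mul_nonneg (hw0 x) (sq_nonneg _)
  have h1 : ∫ x in (0:ℝ)..1, w x * (f x - m) ^ 2 =
      (∫ x in (0:ℝ)..1, w x * f x ^ 2) - 2 * m * m + m ^ 2 * 1 := by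
    have e : ∀ x, w x * (f x - m) ^ 2 =
        w x * f x ^ 2 - 2 * m * (w x * f x) + m ^ 2 * w x := fun x => by ring
    simp only [e]
    rw [intervalIntegral.integral_add, intervalIntegral.integral_sub,
      intervalIntegral.integral_const_mul, intervalIntegral.integral_const_mul, hw1, ← hm]
    all_goals exact Continuous.intervalIntegrable (by fun_prop) _ _
  nlinarith

lemma exp_decay_of_deriv_le {V V' : ℝ → ℝ} {ν ν' K : ℝ} (hν : ν < ν') (hK : 0 ≤ K)
    (hV : ContinuousOn V (Ici 0)) (hd : ∀ t > 0, HasDerivAt V (V' t) t)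
    (hle : ∀ t > 0, V' t ≤ -ν * V t + K * Real.exp (-ν' * t)) {t : ℝ} (ht : 0 ≤ t) :
    V t ≤ (V 0 + K / (ν' - ν)) * Real.exp (-ν * t) := by
  have hν0 : 0 < ν' - ν := sub_pos.2 hν
  have hder : ∀ t > 0, HasDerivAt
      (fun t => Real.exp (ν * t) * V t + K / (ν' - ν) * Real.exp ((ν - ν') * t))
      (Real.exp (ν * t) * (ν * V t + V' t - K * Real.exp (-ν' * t))) t := by
    intro t ht
    have e1 : HasDerivAt (fun t => Real.exp (ν * t)) (Real.exp (ν * t) * ν) t := by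
      simpa using ((hasDerivAt_id t).const_mul ν).exp
    have e2 : HasDerivAt (fun t => Real.exp ((ν - ν') * t))
        (Real.exp ((ν - ν') * t) * (ν - ν')) t := by
      simpa using ((hasDerivAt_id t).const_mul (ν - ν')).exp
    refine ((e1.mul (hd t ht)).add (e2.const_mul (K / (ν' - ν)))).congr_deriv ?_
    have e3 : Real.exp ((ν - ν') * t) = Real.exp (ν * t) * Real.exp (-ν' * t) := by
      rw [← Real.exp_add]; ring_nf
    rw [e3]
    field_simp
    ring
  have hanti := antitoneOn_of_deriv_nonpos (convex_Ici (0:ℝ))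
    (f := fun t => Real.exp (ν * t) * V t + K / (ν' - ν) * Real.exp ((ν - ν') * t))
    (by fun_prop)
    (fun t ht => (hder t (by simpa using ht)).differentiableAt.differentiableWithinAt)
    (fun t ht => by
      have ht : 0 < t := by simpa using ht
      rw [(hder t ht).deriv]
      exact mul_nonpos_of_nonneg_of_nonpos (Real.exp_pos _).le (by linarith [hle t ht]))
  have h := hanti (mem_Ici.2 le_rfl) (mem_Ici.2 ht) ht
  simp only [mul_zero, Real.exp_zero, one_mul, mul_one] at h
  have h2 : Real.exp (ν * t) * V t ≤ V 0 + K / (ν' - ν) := by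
    have : 0 ≤ K / (ν' - ν) * Real.exp ((ν - ν') * t) := by positivity
    linarith
  calc V t = Real.exp (ν * t) * V t * Real.exp (-ν * t) := by
        rw [mul_right_comm, ← Real.exp_add]; simp
    _ ≤ _ := by gcongr

end Calculus

/-- A weight `φ` supported where `q` is bounded below, with a multiplier `h` that increases outside
the support of `φ`. -/
structure Localizer (q : ℝ → ℝ) where
  φ : ℝ → ℝ
  dφ : ℝ → ℝ
  h : ℝ → ℝ
  Q : ℝ
  κ : ℝ
  B : ℝ
  A : ℝ
  cont_φ : Continuous φ
  cont_dφ : Continuous dφ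
  hasDerivAt_φ : ∀ x, HasDerivAt φ (dφ x) x
  hasDerivAt_h : ∀ x, HasDerivAt h (1 - 3 * φ x) x
  φ_nonneg : ∀ x, 0 ≤ φ x
  φ_le : ∀ x, φ x ≤ B
  abs_dφ_le : ∀ x, |dφ x| ≤ A * √(φ x)
  φ_zero : φ 0 = 0
  φ_one : φ 1 = 0
  h_zero : h 0 = 1
  h_one : h 1 = -1
  abs_h_le : ∀ x ∈ Icc (0:ℝ) 1, |h x| ≤ 3
  integral_φ : ∫ x in (0:ℝ)..1, φ x = 1
  Q_nonneg : 0 ≤ Q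
  κ_nonneg : 0 ≤ κ
  A_nonneg : 0 ≤ A
  ae_q : ∀ᵐ x ∂(volume.restrict (Ioo (0:ℝ) 1)), 0 ≤ q x ∧ q x ≤ Q ∧ φ x ≤ κ * q x

lemma Localizer.B_nonneg {q : ℝ → ℝ} (l : Localizer q) : 0 ≤ l.B :=
  (l.φ_nonneg 0).trans (l.φ_le 0)

lemma Localizer.cont_h {q : ℝ → ℝ} (l : Localizer q) : Continuous l.h :=
  continuous_iff_continuousAt.2 fun x => (l.hasDerivAt_h x).continuousAt

lemma hasDerivAt_max_zero_sq (s : ℝ) : HasDerivAt (fun s : ℝ => max s 0 ^ 2) (2 * max s 0) s := by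
  rcases lt_trichotomy s 0 with hs | rfl | hs
  · refine ((hasDerivAt_const s (0:ℝ)).congr_of_eventuallyEq ?_).congr_deriv ?_
    · filter_upwards [eventually_lt_nhds hs] with y hy
      simp [max_eq_right hy.le]
    · simp [max_eq_right hs.le]
  · rw [hasDerivAt_iff_tendsto_slope]
    have h : Filter.Tendsto (fun s : ℝ => max s 0) (nhds 0) (nhds (2 * max 0 0)) := by
      have : Continuous fun s : ℝ => max s 0 := by fun_prop
      simpa using this.tendsto 0
    refine (h.mono_left nhdsWithin_le_nhds).congr' ?_
    filter_upwards [self_mem_nhdsWithin] with y hy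
    have hy : y ≠ 0 := hy
    rcases le_total y 0 with h | h
    · simp [slope_def_field, max_eq_right h]
    · simp only [slope_def_field, max_eq_left h]
      field_simp
      simp [sq]
  · refine ((hasDerivAt_pow 2 s).congr_of_eventuallyEq ?_).congr_deriv ?_
    · filter_upwards [eventually_gt_nhds hs] with y hy
      simp [max_eq_left hy.le]
    · simp [max_eq_left hs.le]

lemma nonempty_localizer {q : ℝ → ℝ} {c d q_min q_max : ℝ}
    (h : AssumptionA2 q c d q_min q_max) : Nonempty (Localizer q) := by
  obtain ⟨-, ⟨Q, hQ⟩, hq0, hc, hcd, hd, hmin, -, hω⟩ := h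
  set ψ : ℝ → ℝ := fun x => max ((x - c) * (d - x)) 0 ^ 2 with hψ
  have hψc : Continuous ψ := by fun_prop
  have hψ0 : ∀ x, 0 ≤ ψ x := fun x => sq_nonneg _
  have hψout : ∀ x, x ∉ Ioo c d → ψ x = 0 := by
    intro x hx
    have : (x - c) * (d - x) ≤ 0 := by
      rw [mem_Ioo, not_and_or, not_lt, not_lt] at hx
      rcases hx with h | h <;> nlinarith
    simp [hψ, max_eq_right this]
  have hψpos : ∀ x ∈ Ioo c d, 0 < ψ x := by
    intro x hx
    have : 0 < (x - c) * (d - x) := mul_pos (sub_pos.2 hx.1) (sub_pos.2 hx.2)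
    simp only [hψ, max_eq_left this.le]
    positivity
  have hI : 0 < ∫ x in (0:ℝ)..1, ψ x := by
    refine intervalIntegral.integral_pos zero_lt_one hψc.continuousOn (fun x _ => hψ0 x)
      ⟨(c + d) / 2, ⟨by linarith, by linarith⟩, hψpos _ ⟨by linarith, by linarith⟩⟩
  set I := ∫ x in (0:ℝ)..1, ψ x with hIdef
  have hψd : ∀ x, HasDerivAt ψ (2 * max ((x - c) * (d - x)) 0 * (c + d - 2 * x)) x := by
    intro x
    have h1 : HasDerivAt (fun x => (x - c) * (d - x)) (c + d - 2 * x) x := by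
      refine (((hasDerivAt_id x).sub_const c).mul ((hasDerivAt_id x).const_sub d)).congr_deriv ?_
      simp only [id]
      ring
    exact (hasDerivAt_max_zero_sq _).comp x h1
  have hψle : ∀ x, ψ x ≤ 1 := by
    intro x
    by_cases hx : x ∈ Ioo c d
    · have h0 : 0 ≤ (x - c) * (d - x) := mul_nonneg (sub_pos.2 hx.1).le (sub_pos.2 hx.2).le
      have h1 : (x - c) * (d - x) ≤ 1 := by nlinarith [hx.1, hx.2]
      simp only [hψ, max_eq_left h0]
      exact pow_le_one₀ h0 h1
    · rw [hψout x hx]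
      exact zero_le_one
  have hφint : ∫ x in (0:ℝ)..1, I⁻¹ * ψ x = 1 := by
    rw [intervalIntegral.integral_const_mul, ← hIdef]
    exact inv_mul_cancel₀ hI.ne'
  have hφc : Continuous fun x => I⁻¹ * ψ x := by fun_prop
  have hcum : ∀ x ∈ Icc (0:ℝ) 1,
      0 ≤ (∫ y in (0:ℝ)..x, I⁻¹ * ψ y) ∧ (∫ y in (0:ℝ)..x, I⁻¹ * ψ y) ≤ 1 := by
    intro x hx
    have h1 : 0 ≤ ∫ y in (0:ℝ)..x, I⁻¹ * ψ y :=
      intervalIntegral.integral_nonneg hx.1 fun y _ => mul_nonneg (inv_pos.2 hI).le (hψ0 y)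
    have h2 : 0 ≤ ∫ y in x..1, I⁻¹ * ψ y :=
      intervalIntegral.integral_nonneg hx.2 fun y _ => mul_nonneg (inv_pos.2 hI).le (hψ0 y)
    have h3 := intervalIntegral.integral_add_adjacent_intervals
      (hφc.intervalIntegrable (μ := volume) 0 x) (hφc.intervalIntegrable x 1)
    exact ⟨h1, by linarith⟩
  refine ⟨{
    φ := fun x => I⁻¹ * ψ x
    dφ := fun x => I⁻¹ * (2 * max ((x - c) * (d - x)) 0 * (c + d - 2 * x))
    h := fun x => 1 + x - 3 * ∫ y in (0:ℝ)..x, I⁻¹ * ψ y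
    Q := |Q|
    κ := I⁻¹ / q_min
    B := I⁻¹
    A := 2 * √I⁻¹
    cont_φ := hφc
    cont_dφ := by fun_prop
    hasDerivAt_φ := fun x => (hψd x).const_mul _
    hasDerivAt_h := fun x => ?_
    φ_nonneg := fun x => mul_nonneg (inv_pos.2 hI).le (hψ0 x)
    φ_le := fun x => mul_le_of_le_one_right (inv_pos.2 hI).le (hψle x)
    abs_dφ_le := fun x => ?_
    φ_zero := by rw [hψout 0 fun h => by linarith [h.1], mul_zero]
    φ_one := by rw [hψout 1 fun h => by linarith [h.2], mul_zero]
    h_zero := by simp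
    h_one := by rw [hφint]; norm_num
    abs_h_le := fun x hx => ?_
    integral_φ := hφint
    Q_nonneg := abs_nonneg Q
    κ_nonneg := by positivity
    A_nonneg := by positivity
    ae_q := ?_ }⟩
  · exact ((hasDerivAt_id x).const_add 1).sub
      ((hφc.integral_hasStrictDerivAt 0 x).hasDerivAt.const_mul 3)
  · by_cases hx : x ∈ Ioo c d
    · have h0 : 0 < (x - c) * (d - x) := mul_pos (sub_pos.2 hx.1) (sub_pos.2 hx.2)
      have hI' : 0 ≤ I⁻¹ := (inv_pos.2 hI).le
      simp only [hψ, max_eq_left h0.le]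
      rw [Real.sqrt_mul hI', Real.sqrt_sq h0.le, abs_mul, abs_mul, abs_mul, abs_of_nonneg hI',
        abs_of_pos h0, abs_two]
      have h1 : |c + d - 2 * x| ≤ 1 := by
        rw [abs_le]
        constructor <;> linarith [hx.1, hx.2]
      calc I⁻¹ * (2 * ((x - c) * (d - x)) * |c + d - 2 * x|)
          ≤ I⁻¹ * (2 * ((x - c) * (d - x)) * 1) := by gcongr
        _ = (√I⁻¹ * √I⁻¹) * (2 * ((x - c) * (d - x))) := by rw [Real.mul_self_sqrt hI']; ring
        _ = _ := by ring
    · have h0 : max ((x - c) * (d - x)) 0 = 0 := by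
        have := hψout x hx
        simpa [hψ] using this
      rw [h0]
      simp
      positivity
  · have := hcum x hx
    rw [abs_le]
    constructor <;> linarith [hx.1, hx.2]
  · have hω' : ∀ᵐ x ∂(volume.restrict (Ioo (0:ℝ) 1)), x ∈ Ioo c d → q_min ≤ q x := by
      refine ae_restrict_of_ae ?_
      filter_upwards [(ae_restrict_iff' measurableSet_Ioo).1 hω] with x hx hxm
      exact (hx hxm).1
    filter_upwards [hq0, hω', ae_restrict_mem measurableSet_Ioo] with x h1 h2 hx
    refine ⟨h1, (le_abs_self _).trans ((hQ x (Ioo_subset_Icc_self hx)).trans (le_abs_self _)), ?_⟩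
    by_cases hxω : x ∈ Ioo c d
    · have h3 := h2 hxω
      calc I⁻¹ * ψ x ≤ I⁻¹ * 1 := by
            gcongr
            exact hψle x
        _ = I⁻¹ / q_min * q_min := by field_simp
        _ ≤ I⁻¹ / q_min * q x := by gcongr
    · rw [hψout x hxω, mul_zero]
      positivity

/-- The first-order form of system (S) for `a ≡ 1`, with all functions extended continuously to the
plane: `T` and `X` are the time and space derivatives of the displacement `v`, and `w` is the
damping force. -/
structure FirstOrderSystem (q : ℝ → ℝ) (α₁ α₂ β₁ γ₁ μ₁ : ℝ) where
  T : ℝ → ℝ → ℝ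
  X : ℝ → ℝ → ℝ
  v : ℝ → ℝ → ℝ
  w : ℝ → ℝ → ℝ
  Tx : ℝ → ℝ → ℝ
  Xx : ℝ → ℝ → ℝ
  η₁ : ℝ → ℝ
  η₂ : ℝ → ℝ
  ζ : ℝ → ℝ
  cont_T : Continuous (Function.uncurry T)
  cont_X : Continuous (Function.uncurry X)
  cont_v : Continuous (Function.uncurry v)
  cont_w : Continuous (Function.uncurry w)
  cont_Tx : Continuous (Function.uncurry Tx)
  cont_Xx : Continuous (Function.uncurry Xx)
  cont_η₁ : Continuous η₁
  cont_η₂ : Continuous η₂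
  cont_ζ : Continuous ζ
  T_t : ∀ t > 0, ∀ x ∈ Ioo (0:ℝ) 1, HasDerivAt (fun s => T s x) (Xx t x - w t x) t
  X_t : ∀ t > 0, ∀ x ∈ Ioo (0:ℝ) 1, HasDerivAt (fun s => X s x) (Tx t x) t
  v_t : ∀ t > 0, ∀ x ∈ Ioo (0:ℝ) 1, HasDerivAt (fun s => v s x) (T t x) t
  T_x : ∀ t > 0, ∀ x ∈ Ioo (0:ℝ) 1, HasDerivAt (T t) (Tx t x) x
  X_x : ∀ t > 0, ∀ x ∈ Ioo (0:ℝ) 1, HasDerivAt (X t) (Xx t x) x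
  v_x : ∀ t ≥ 0, ∀ x ∈ Ioo (0:ℝ) 1, HasDerivAt (v t) (X t x) x
  damping : ∀ t > 0, ∀ᵐ x ∂(volume.restrict (Ioo (0:ℝ) 1)), w t x = q x * T t x
  T_one : ∀ t ≥ 0, T t 1 = η₁ t
  T_zero : ∀ t ≥ 0, T t 0 = ζ t
  v_one : ∀ t ≥ 0, v t 1 = η₂ t
  ode₁ : ∀ t > 0, HasDerivAt η₁ (-α₁ * η₁ t - α₂ * η₂ t - β₁ * X t 1) t
  ode₂ : ∀ t > 0, HasDerivAt η₂ (η₁ t) t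
  ode₃ : ∀ t > 0, HasDerivAt ζ (-γ₁ * ζ t + μ₁ * X t 0) t

namespace FirstOrderSystem

variable {q : ℝ → ℝ} {α₁ α₂ β₁ γ₁ μ₁ : ℝ} (S : FirstOrderSystem q α₁ α₂ β₁ γ₁ μ₁)
  (l : Localizer q)

/-- The left-moving Riemann invariant. -/
def ρ (t x : ℝ) : ℝ := S.X t x + S.T t x

/-- The right-moving Riemann invariant. -/
def ξ (t x : ℝ) : ℝ := S.X t x - S.T t x

/-- The `L^p` energy of the Riemann invariants. -/
noncomputable def W (p t : ℝ) : ℝ := ∫ x in (0:ℝ)..1, (|S.ρ t x| ^ p + |S.ξ t x| ^ p)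

/-- The localized `p`-th moment of the displacement. -/
noncomputable def P (p t : ℝ) : ℝ := ∫ x in (0:ℝ)..1, l.φ x * |S.v t x| ^ p

/-- The Lyapunov functional. -/
noncomputable def V (p N t : ℝ) : ℝ :=
  ∫ x in (0:ℝ)..1, lyapDensity p N (l.h x) (l.φ x) (S.ρ t x) (S.ξ t x) (S.v t x)

lemma cont_ρ : Continuous (Function.uncurry S.ρ) := S.cont_X.add S.cont_T

lemma cont_ξ : Continuous (Function.uncurry S.ξ) := S.cont_X.sub S.cont_T

lemma cont_lyapDensity {p : ℝ} (hp : 2 ≤ p) (N : ℝ) : Continuous (Function.uncurry fun t x =>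
    lyapDensity p N (l.h x) (l.φ x) (S.ρ t x) (S.ξ t x) (S.v t x)) := by
  have := S.cont_ρ
  have := S.cont_ξ
  have := S.cont_v
  have := l.cont_h
  have := l.cont_φ
  have := continuous_signedPow hp
  have hc : Continuous fun s : ℝ => |s| ^ p := continuous_abs_rpow (by linarith)
  have h1 : Continuous fun z : ℝ × ℝ => |S.ρ z.1 z.2| ^ p := hc.comp (by fun_prop)
  have h2 : Continuous fun z : ℝ × ℝ => |S.ξ z.1 z.2| ^ p := hc.comp (by fun_prop)
  simp only [lyapDensity, Function.uncurry_def]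
  fun_prop

lemma continuous_V {p : ℝ} (hp : 2 ≤ p) (N : ℝ) : Continuous (S.V l p N) :=
  intervalIntegral.continuous_parametric_intervalIntegral_of_continuous'
    (S.cont_lyapDensity l hp N) 0 1

lemma cont_energyDensity {p : ℝ} (hp : 2 ≤ p) :
    Continuous (Function.uncurry fun t x => |S.ρ t x| ^ p + |S.ξ t x| ^ p) := by
  have hc : Continuous fun s : ℝ => |s| ^ p := continuous_abs_rpow (by linarith)
  exact (hc.comp S.cont_ρ).add (hc.comp S.cont_ξ)

lemma cont_moment {p : ℝ} (hp : 2 ≤ p) :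
    Continuous (Function.uncurry fun t x => l.φ x * |S.v t x| ^ p) := by
  have hc : Continuous fun s : ℝ => |s| ^ p := continuous_abs_rpow (by linarith)
  exact (l.cont_φ.comp continuous_snd).mul (hc.comp S.cont_v)

lemma W_nonneg (p t : ℝ) : 0 ≤ S.W p t :=
  intervalIntegral.integral_nonneg zero_le_one fun x _ => by positivity

lemma P_nonneg (p t : ℝ) : 0 ≤ S.P l p t :=
  intervalIntegral.integral_nonneg zero_le_one fun x _ =>
    mul_nonneg (l.φ_nonneg x) (by positivity)

lemma exists_V_bounds {p : ℝ} (hp : 2 ≤ p) : ∃ C ≥ 0, ∀ N ≥ 5,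
    ∀ S : FirstOrderSystem q α₁ α₂ β₁ γ₁ μ₁, ∀ t,
      S.W p t - C * S.P l p t ≤ S.V l p N t ∧
      S.V l p N t ≤ (N + 4) * S.W p t + C * S.P l p t := by
  have hp0 : 0 ≤ p := by linarith
  obtain ⟨C, hC, H⟩ := exists_lyapDensity_bounds hp l.B_nonneg
  refine ⟨C, hC, fun N hN S t => ?_⟩
  have c1 : Continuous fun x => |S.ρ t x| ^ p + |S.ξ t x| ^ p :=
    (S.cont_energyDensity hp).comp (by fun_prop : Continuous fun x : ℝ => (t, x))
  have c2 : Continuous fun x => l.φ x * |S.v t x| ^ p :=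
    (S.cont_moment l hp).comp (by fun_prop : Continuous fun x : ℝ => (t, x))
  have c3 : Continuous fun x =>
      lyapDensity p N (l.h x) (l.φ x) (S.ρ t x) (S.ξ t x) (S.v t x) :=
    (S.cont_lyapDensity l hp N).comp (by fun_prop : Continuous fun x : ℝ => (t, x))
  constructor
  · rw [W, P, V, ← intervalIntegral.integral_const_mul, ← intervalIntegral.integral_sub
      (c1.intervalIntegrable _ _) ((c2.intervalIntegrable _ _).const_mul _)]
    exact integral_unit_mono (by fun_prop) c3 fun x hx =>
      (H N hN _ _ _ _ _ (l.φ_nonneg x) (l.φ_le x) (l.abs_h_le x hx)).1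
  · rw [W, P, V, ← intervalIntegral.integral_const_mul, ← intervalIntegral.integral_const_mul,
      ← intervalIntegral.integral_add ((c1.intervalIntegrable _ _).const_mul _)
      ((c2.intervalIntegrable _ _).const_mul _)]
    exact integral_unit_mono c3 (by fun_prop) fun x hx =>
      (H N hN _ _ _ _ _ (l.φ_nonneg x) (l.φ_le x) (l.abs_h_le x hx)).2

/-- The decay of the Lyapunov functional up to lower-order and boundary terms. -/
lemma exists_V_deriv_le {p : ℝ} (hp : 2 ≤ p) : ∃ N ≥ 5, ∃ C ≥ 0,
    ∀ S : FirstOrderSystem q α₁ α₂ β₁ γ₁ μ₁, ∀ t > 0, ∃ V',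
      HasDerivAt (S.V l p N) V' t ∧
      V' ≤ -(1 / 2) * S.W p t + C * (S.P l p t + |S.η₁ t| ^ p + |S.ζ t| ^ p) := by
  have hp0 : 0 ≤ p := by linarith
  have hp2 : 0 ≤ p - 2 := by linarith
  obtain ⟨N, hN, C₁, hC₁, H⟩ :=
    exists_lyapDensity_decay hp l.Q_nonneg l.κ_nonneg l.B_nonneg l.A_nonneg
  obtain ⟨C₂, hC₂, hb⟩ := exists_abs_add_rpow_le hp N
  refine ⟨N, hN, C₁ + C₂, by positivity, fun S t ht => ?_⟩
  have cρ := S.cont_ρ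
  have cξ := S.cont_ξ
  have cv := S.cont_v
  have cT := S.cont_T
  have cX := S.cont_X
  have cw := S.cont_w
  have cTx := S.cont_Tx
  have cXx := S.cont_Xx
  have ch := l.cont_h
  have cφ := l.cont_φ
  have cdφ := l.cont_dφ
  have cf := continuous_signedPow hp
  have hcp : Continuous fun s : ℝ => |s| ^ p := continuous_abs_rpow (by linarith)
  have hcp2 : Continuous fun s : ℝ => |s| ^ (p - 2) := continuous_abs_rpow (by linarith)
  have cρ2 : Continuous (Function.uncurry fun t x => |S.ρ t x| ^ (p - 2)) := hcp2.comp cρ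
  have cρp : Continuous (Function.uncurry fun t x => |S.ρ t x| ^ p) := hcp.comp cρ
  have cξp : Continuous (Function.uncurry fun t x => |S.ξ t x| ^ p) := hcp.comp cξ
  let F' : ℝ → ℝ → ℝ := fun t x =>
    (N + l.h x) * (p * signedPow p (S.ρ t x) * (S.Tx t x + (S.Xx t x - S.w t x)))
    + (N - l.h x) * (p * signedPow p (S.ξ t x) * (S.Tx t x - (S.Xx t x - S.w t x)))
    + 9 * (l.φ x * (S.T t x * signedPow p (S.ρ t x)
      + S.v t x * ((p - 1) * |S.ρ t x| ^ (p - 2) * (S.Tx t x + (S.Xx t x - S.w t x)))))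
  let G : ℝ → ℝ := fun x => (N + l.h x) * |S.ρ t x| ^ p - (N - l.h x) * |S.ξ t x| ^ p
    + 9 * (l.φ x * (S.v t x * signedPow p (S.ρ t x)))
  let G' : ℝ → ℝ := fun x =>
    ((1 - 3 * l.φ x) * |S.ρ t x| ^ p
      + (N + l.h x) * (p * signedPow p (S.ρ t x) * (S.Xx t x + S.Tx t x)))
    - (-(1 - 3 * l.φ x) * |S.ξ t x| ^ p
      + (N - l.h x) * (p * signedPow p (S.ξ t x) * (S.Xx t x - S.Tx t x)))
    + 9 * (l.dφ x * (S.v t x * signedPow p (S.ρ t x)) + l.φ x * (S.X t x * signedPow p (S.ρ t x)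
      + S.v t x * ((p - 1) * |S.ρ t x| ^ (p - 2) * (S.Xx t x + S.Tx t x))))
  have cF' : Continuous (Function.uncurry F') := by
    simp only [F', Function.uncurry_def] at *
    fun_prop
  have cG : Continuous G := by
    simp only [G]
    fun_prop
  have cG' : Continuous G' := by
    simp only [G']
    fun_prop
  have hder : HasDerivAt (S.V l p N) (∫ x in (0:ℝ)..1, F' t x) t := by
    refine hasDerivAt_integral_unit (S.cont_lyapDensity l hp N) cF' (fun t ht x hx => ?_)
      (by simp) (by simp) ht
    have dρ : HasDerivAt (fun s => S.ρ s x) (S.Tx t x + (S.Xx t x - S.w t x)) t :=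
      (S.X_t t ht x hx).add (S.T_t t ht x hx)
    have dξ : HasDerivAt (fun s => S.ξ s x) (S.Tx t x - (S.Xx t x - S.w t x)) t :=
      (S.X_t t ht x hx).sub (S.T_t t ht x hx)
    exact ((((hasDerivAt_abs_rpow_signedPow hp _).comp t dρ).const_mul _).add
      (((hasDerivAt_abs_rpow_signedPow hp _).comp t dξ).const_mul _)).add
      ((((S.v_t t ht x hx).mul ((hasDerivAt_signedPow hp _).comp t dρ)).const_mul _).const_mul 9)
  have hG : ∫ x in (0:ℝ)..1, G' x = G 1 - G 0 := by
    refine integral_unit_eq_sub cG cG' fun x hx => ?_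
    have dρ : HasDerivAt (fun y => S.ρ t y) (S.Xx t x + S.Tx t x) x :=
      (S.X_x t ht x hx).add (S.T_x t ht x hx)
    have dξ : HasDerivAt (fun y => S.ξ t y) (S.Xx t x - S.Tx t x) x :=
      (S.X_x t ht x hx).sub (S.T_x t ht x hx)
    exact ((((l.hasDerivAt_h x).const_add N).mul
        ((hasDerivAt_abs_rpow_signedPow hp _).comp x dρ)).sub
      (((l.hasDerivAt_h x).const_sub N).mul ((hasDerivAt_abs_rpow_signedPow hp _).comp x dξ))).add
      (((l.hasDerivAt_φ x).mul
        ((S.v_x t ht.le x hx).mul ((hasDerivAt_signedPow hp _).comp x dρ))).const_mul 9)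
  have hbdry : G 1 - G 0 ≤ C₂ * (|S.η₁ t| ^ p + |S.ζ t| ^ p) := by
    have h1 := hb (S.ξ t 1) (S.η₁ t)
    have h0 := hb (S.ρ t 0) (-S.ζ t)
    rw [abs_neg] at h0
    have e1 : S.ξ t 1 + 2 * S.η₁ t = S.ρ t 1 := by
      rw [ξ, ρ, S.T_one t ht.le]; ring
    have e0 : S.ρ t 0 + 2 * -S.ζ t = S.ξ t 0 := by
      rw [ξ, ρ, S.T_zero t ht.le]; ring
    rw [e1] at h1
    rw [e0] at h0
    simp only [G, l.φ_one, l.φ_zero, l.h_one, l.h_zero]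
    linarith
  have hrem : ∫ x in (0:ℝ)..1, (F' t x - G' x) ≤ ∫ x in (0:ℝ)..1,
      (-(1 / 2) * (|S.ρ t x| ^ p + |S.ξ t x| ^ p) + C₁ * (l.φ x * |S.v t x| ^ p)) := by
    have c2 : Continuous fun x => l.φ x * |S.v t x| ^ p :=
      (S.cont_moment l hp).comp (by fun_prop : Continuous fun x : ℝ => (t, x))
    refine integral_unit_mono_ae (by fun_prop) (by fun_prop) ?_
    filter_upwards [S.damping t ht, l.ae_q, ae_restrict_mem measurableSet_Ioo] with x hw hq hx
    have key := H (S.ρ t x) (S.ξ t x) (S.v t x) (q x) (l.φ x) (l.dφ x) (l.h x) hq.1 hq.2.1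
      (l.φ_nonneg x) (l.φ_le x) hq.2.2 (l.abs_dφ_le x) (l.abs_h_le x (Ioo_subset_Icc_self hx))
    refine le_trans (le_of_eq ?_) key
    have eT : (S.ρ t x - S.ξ t x) / 2 = S.T t x := by rw [ρ, ξ]; ring
    have eξ : S.X t x = S.ξ t x + S.T t x := by rw [ξ]; ring
    rw [eT]
    simp only [F', G', hw, eξ]
    ring
  refine ⟨_, hder, ?_⟩
  have c1 : Continuous fun x => |S.ρ t x| ^ p + |S.ξ t x| ^ p :=
    (S.cont_energyDensity hp).comp (by fun_prop : Continuous fun x : ℝ => (t, x))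
  have c2 : Continuous fun x => l.φ x * |S.v t x| ^ p :=
    (S.cont_moment l hp).comp (by fun_prop : Continuous fun x : ℝ => (t, x))
  have cF : Continuous (F' t) := cF'.comp (by fun_prop : Continuous fun x : ℝ => (t, x))
  rw [intervalIntegral.integral_sub (cF.intervalIntegrable _ _) (cG'.intervalIntegrable _ _), hG,
    intervalIntegral.integral_add ((c1.intervalIntegrable _ _).const_mul _)
      ((c2.intervalIntegrable _ _).const_mul _), intervalIntegral.integral_const_mul,
    intervalIntegral.integral_const_mul] at hrem
  have hη : 0 ≤ |S.η₁ t| ^ p + |S.ζ t| ^ p := by positivity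
  have hP := S.P_nonneg l p t
  change _ ≤ -(1 / 2) * S.W p t + C₁ * S.P l p t at hrem
  nlinarith [mul_nonneg hC₁ hη, mul_nonneg hC₂ hP]

end FirstOrderSystem

/-- The twice iterated weighted primitive `x ↦ ∫ₓ¹ ∫₀ʸ φ f`. -/
noncomputable def doublePrimitive (φ f : ℝ → ℝ) (x : ℝ) : ℝ :=
  ∫ y in x..1, ∫ s in (0:ℝ)..y, φ s * f s

lemma integral_abs_sub_le {φ f : ℝ → ℝ} (hφ : Continuous φ) (hf : Continuous f)
    (hφ0 : ∀ x, 0 ≤ φ x) {y : ℝ} (hy : y ∈ Icc (0:ℝ) 1) :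
    |∫ s in (0:ℝ)..y, φ s * f s| ≤ ∫ s in (0:ℝ)..1, φ s * |f s| := by
  have h1 : |∫ s in (0:ℝ)..y, φ s * f s| ≤ ∫ s in (0:ℝ)..y, φ s * |f s| := by
    refine (intervalIntegral.abs_integral_le_integral_abs hy.1).trans (le_of_eq ?_)
    exact intervalIntegral.integral_congr fun s _ => by simp [abs_mul, abs_of_nonneg (hφ0 s)]
  refine h1.trans (intervalIntegral.integral_mono_interval le_rfl hy.1 hy.2 ?_ ?_)
  · exact Filter.Eventually.of_forall fun s => mul_nonneg (hφ0 s) (abs_nonneg _)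
  · exact Continuous.intervalIntegrable (by fun_prop) _ _

lemma sq_integral_abs_le {φ f : ℝ → ℝ} (hφ : Continuous φ) (hf : Continuous f)
    (hφ0 : ∀ x, 0 ≤ φ x) (hφ1 : ∫ x in (0:ℝ)..1, φ x = 1) :
    (∫ s in (0:ℝ)..1, φ s * |f s|) ^ 2 ≤ ∫ s in (0:ℝ)..1, φ s * f s ^ 2 := by
  simpa only [sq_abs] using sq_integral_weight_mul_le hφ hf.abs hφ0 hφ1

lemma sq_primitive_le {φ f : ℝ → ℝ} (hφ : Continuous φ) (hf : Continuous f)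
    (hφ0 : ∀ x, 0 ≤ φ x) (hφ1 : ∫ x in (0:ℝ)..1, φ x = 1) {y : ℝ} (hy : y ∈ Icc (0:ℝ) 1) :
    (∫ s in (0:ℝ)..y, φ s * f s) ^ 2 ≤ ∫ s in (0:ℝ)..1, φ s * f s ^ 2 :=
  (sq_le_sq' (by linarith [(abs_le.1 (integral_abs_sub_le hφ hf hφ0 hy)).1])
    (abs_le.1 (integral_abs_sub_le hφ hf hφ0 hy)).2).trans (sq_integral_abs_le hφ hf hφ0 hφ1)

lemma sq_doublePrimitive_le {φ f : ℝ → ℝ} (hφ : Continuous φ) (hf : Continuous f)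
    (hφ0 : ∀ x, 0 ≤ φ x) (hφ1 : ∫ x in (0:ℝ)..1, φ x = 1) {x : ℝ} (hx : x ∈ Icc (0:ℝ) 1) :
    doublePrimitive φ f x ^ 2 ≤ ∫ s in (0:ℝ)..1, φ s * f s ^ 2 := by
  refine le_trans ?_ (sq_integral_abs_le hφ hf hφ0 hφ1)
  set M := ∫ s in (0:ℝ)..1, φ s * |f s| with hM
  have hM0 : 0 ≤ M := intervalIntegral.integral_nonneg zero_le_one fun s _ =>
    mul_nonneg (hφ0 s) (abs_nonneg _)
  have h : |doublePrimitive φ f x| ≤ M := by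
    have := intervalIntegral.norm_integral_le_of_norm_le_const (a := x) (b := 1) (C := M)
      (f := fun y => ∫ s in (0:ℝ)..y, φ s * f s) fun y hy => by
        rw [uIoc_of_le hx.2] at hy
        exact integral_abs_sub_le hφ hf hφ0 ⟨hx.1.trans hy.1.le, hy.2⟩
    refine this.trans ?_
    rw [abs_of_nonneg (by linarith [hx.2])]
    nlinarith [hx.1]
  exact sq_le_sq' (by linarith [(abs_le.1 h).1]) (abs_le.1 h).2

lemma continuous_primitive_uncurry {φ : ℝ → ℝ} {f : ℝ → ℝ → ℝ} (hφ : Continuous φ)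
    (hf : Continuous (Function.uncurry f)) :
    Continuous (Function.uncurry fun t y => ∫ s in (0:ℝ)..y, φ s * f t s) :=
  intervalIntegral.continuous_parametric_primitive_of_continuous
    (f := fun t s => φ s * f t s) (by fun_prop)

lemma continuous_doublePrimitive_uncurry {φ : ℝ → ℝ} {f : ℝ → ℝ → ℝ} (hφ : Continuous φ)
    (hf : Continuous (Function.uncurry f)) :
    Continuous (Function.uncurry fun t x => doublePrimitive φ (f t) x) := by
  have := intervalIntegral.continuous_parametric_primitive_of_continuous (a₀ := 1) (μ := volume)
    (f := fun t y => ∫ s in (0:ℝ)..y, φ s * f t s) (continuous_primitive_uncurry hφ hf)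
  refine this.neg.congr fun z => ?_
  rw [Function.uncurry, doublePrimitive, intervalIntegral.integral_symm]
  rfl

lemma hasDerivAt_doublePrimitive {φ f : ℝ → ℝ} (hφ : Continuous φ) (hf : Continuous f) (x : ℝ) :
    HasDerivAt (doublePrimitive φ f) (-∫ s in (0:ℝ)..x, φ s * f s) x := by
  have hc : Continuous fun y => ∫ s in (0:ℝ)..y, φ s * f s :=
    intervalIntegral.continuous_primitive (fun a b => (hφ.mul hf).intervalIntegrable a b) 0
  exact intervalIntegral.integral_hasDerivAt_left (hc.intervalIntegrable _ _)
    hc.stronglyMeasurable.stronglyMeasurableAtFilter hc.continuousAt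

namespace FirstOrderSystem

variable {q : ℝ → ℝ} {α₁ α₂ β₁ γ₁ μ₁ : ℝ} (S : FirstOrderSystem q α₁ α₂ β₁ γ₁ μ₁)
  (l : Localizer q)

/-- The power dissipated in the domain. -/
noncomputable def damp (t : ℝ) : ℝ := ∫ x in (0:ℝ)..1, S.w t x * S.T t x

/-- The `L²` energy. -/
noncomputable def energy (t : ℝ) : ℝ :=
  (∫ x in (0:ℝ)..1, (S.T t x ^ 2 + S.X t x ^ 2)) / 2 + S.η₁ t ^ 2 / (2 * β₁)
    + α₂ * S.η₂ t ^ 2 / (2 * β₁) + S.ζ t ^ 2 / (2 * μ₁)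

/-- The solution of `-zₓₓ = φ v` with `z = c η₂` at `1` and `zₓ = 0` at `0`. -/
noncomputable def potential (c t x : ℝ) : ℝ := c * S.η₂ t + doublePrimitive l.φ (S.v t) x

/-- The time derivative of `potential`. -/
noncomputable def potentialRate (c t x : ℝ) : ℝ := c * S.η₁ t + doublePrimitive l.φ (S.T t) x

/-- The functional whose derivative controls the displacement. -/
noncomputable def crossTerm (c t : ℝ) : ℝ :=
  (∫ x in (0:ℝ)..1, S.potential l c t x * S.T t x)
    + c / β₁ * (S.η₁ t * S.η₂ t + α₁ * S.η₂ t ^ 2 / 2) + S.potential l c t 0 * S.ζ t / μ₁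

lemma continuous_T (t : ℝ) : Continuous (S.T t) :=
  S.cont_T.comp (by fun_prop : Continuous fun x : ℝ => (t, x))

lemma continuous_X (t : ℝ) : Continuous (S.X t) :=
  S.cont_X.comp (by fun_prop : Continuous fun x : ℝ => (t, x))

lemma continuous_v (t : ℝ) : Continuous (S.v t) :=
  S.cont_v.comp (by fun_prop : Continuous fun x : ℝ => (t, x))

lemma continuous_w (t : ℝ) : Continuous (S.w t) :=
  S.cont_w.comp (by fun_prop : Continuous fun x : ℝ => (t, x))

lemma W_two (t : ℝ) : S.W 2 t = 2 * ∫ x in (0:ℝ)..1, (S.T t x ^ 2 + S.X t x ^ 2) := by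
  rw [W, ← intervalIntegral.integral_const_mul]
  refine intervalIntegral.integral_congr fun x _ => ?_
  simp only [Real.rpow_two, sq_abs, ρ, ξ]
  ring

lemma P_two (t : ℝ) : S.P l 2 t = ∫ x in (0:ℝ)..1, l.φ x * S.v t x ^ 2 := by
  simp only [P, Real.rpow_two, sq_abs]

lemma integral_φ_T_sq_le {t : ℝ} (ht : 0 < t) :
    ∫ x in (0:ℝ)..1, l.φ x * S.T t x ^ 2 ≤ l.κ * S.damp t := by
  have := S.continuous_T t
  have := S.continuous_w t
  have := l.cont_φ
  rw [damp, ← intervalIntegral.integral_const_mul]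
  refine integral_unit_mono_ae (by fun_prop) (by fun_prop) ?_
  filter_upwards [S.damping t ht, l.ae_q] with x hw hq
  rw [hw]
  nlinarith [mul_le_mul_of_nonneg_right hq.2.2 (sq_nonneg (S.T t x))]

lemma integral_w_sq_le {t : ℝ} (ht : 0 < t) :
    ∫ x in (0:ℝ)..1, S.w t x ^ 2 ≤ l.Q * S.damp t := by
  have := S.continuous_T t
  have := S.continuous_w t
  rw [damp, ← intervalIntegral.integral_const_mul]
  refine integral_unit_mono_ae (by fun_prop) (by fun_prop) ?_
  filter_upwards [S.damping t ht, l.ae_q] with x hw hq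
  rw [hw]
  nlinarith [mul_le_mul_of_nonneg_right hq.2.1 (mul_nonneg hq.1 (sq_nonneg (S.T t x)))]

lemma damp_nonneg (l : Localizer q) {t : ℝ} (ht : 0 < t) : 0 ≤ S.damp t := by
  have := S.continuous_T t
  have := S.continuous_w t
  refine le_of_eq_of_le (by simp) (integral_unit_mono_ae (f := fun _ => 0)
    (g := fun x => S.w t x * S.T t x) (by fun_prop) (by fun_prop) ?_)
  filter_upwards [S.damping t ht, l.ae_q] with x hw hq
  rw [hw]
  nlinarith [mul_nonneg hq.1 (sq_nonneg (S.T t x))]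

lemma cont_potential (c : ℝ) : Continuous (Function.uncurry (S.potential l c)) := by
  have h := continuous_doublePrimitive_uncurry l.cont_φ S.cont_v
  have := S.cont_η₂
  exact (by fun_prop : Continuous fun z : ℝ × ℝ => c * S.η₂ z.1).add h

lemma cont_potentialRate (c : ℝ) : Continuous (Function.uncurry (S.potentialRate l c)) := by
  have h := continuous_doublePrimitive_uncurry l.cont_φ S.cont_T
  have := S.cont_η₁
  exact (by fun_prop : Continuous fun z : ℝ × ℝ => c * S.η₁ z.1).add h

lemma hasDerivAt_potential (c : ℝ) {t x : ℝ} (ht : 0 < t) (hx : x ∈ Icc (0:ℝ) 1) :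
    HasDerivAt (fun s => S.potential l c s x) (S.potentialRate l c t x) t := by
  have hp := continuous_primitive_uncurry l.cont_φ S.cont_v
  have hp' := continuous_primitive_uncurry l.cont_φ S.cont_T
  have hφ := l.cont_φ
  have hv := S.cont_v
  have hT := S.cont_T
  refine ((S.ode₂ t ht).const_mul c).add (hasDerivAt_integral_unit hp hp' ?_ hx (by simp) ht)
  intro t ht y hy
  exact hasDerivAt_integral_unit (F := fun t s => l.φ s * S.v t s)
    (F' := fun t s => l.φ s * S.T t s) (by fun_prop) (by fun_prop)
    (fun t ht s hs => (S.v_t t ht s hs).const_mul _) (by simp) (Ioo_subset_Icc_self hy) ht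

lemma potential_sq_le (c t : ℝ) {x : ℝ} (hx : x ∈ Icc (0:ℝ) 1) :
    S.potential l c t x ^ 2 ≤ 2 * c ^ 2 * S.η₂ t ^ 2 + 2 * S.P l 2 t := by
  have := sq_doublePrimitive_le l.cont_φ (S.continuous_v t) l.φ_nonneg l.integral_φ hx
  rw [potential, P_two]
  nlinarith [sq_nonneg (c * S.η₂ t - doublePrimitive l.φ (S.v t) x)]

lemma potentialRate_sq_le (c : ℝ) {t x : ℝ} (ht : 0 < t) (hx : x ∈ Icc (0:ℝ) 1) :
    S.potentialRate l c t x ^ 2 ≤ 2 * c ^ 2 * S.η₁ t ^ 2 + 2 * (l.κ * S.damp t) := by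
  have := sq_doublePrimitive_le l.cont_φ (S.continuous_T t) l.φ_nonneg l.integral_φ hx
  have := S.integral_φ_T_sq_le l ht
  rw [potentialRate]
  nlinarith [sq_nonneg (c * S.η₁ t - doublePrimitive l.φ (S.T t) x)]

lemma continuous_energy : Continuous S.energy := by
  have := S.cont_η₁
  have := S.cont_η₂
  have := S.cont_ζ
  have hX := S.cont_X
  have hT := S.cont_T
  have : Continuous fun t => ∫ x in (0:ℝ)..1, (S.T t x ^ 2 + S.X t x ^ 2) :=
    intervalIntegral.continuous_parametric_intervalIntegral_of_continuous' (by fun_prop) 0 1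
  unfold energy
  fun_prop

lemma continuous_crossTerm (c : ℝ) : Continuous (S.crossTerm l c) := by
  have := S.cont_η₁
  have := S.cont_η₂
  have := S.cont_ζ
  have hz := S.cont_potential l c
  have hT := S.cont_T
  have : Continuous fun t => ∫ x in (0:ℝ)..1, S.potential l c t x * S.T t x :=
    intervalIntegral.continuous_parametric_intervalIntegral_of_continuous' (by fun_prop) 0 1
  unfold crossTerm
  fun_prop

lemma hasDerivAt_energy (hβ : 0 < β₁) (hμ : 0 < μ₁) {t : ℝ} (ht : 0 < t) :
    HasDerivAt S.energy
      (-(S.damp t + α₁ / β₁ * S.η₁ t ^ 2 + γ₁ / μ₁ * S.ζ t ^ 2)) t := by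
  have hX := S.cont_X
  have hT := S.cont_T
  have hXx := S.cont_Xx
  have hTx := S.cont_Tx
  have hw := S.cont_w
  have h1 : HasDerivAt (fun t => ∫ x in (0:ℝ)..1, (S.T t x ^ 2 + S.X t x ^ 2))
      (∫ x in (0:ℝ)..1, (2 * (S.Tx t x * S.X t x + S.T t x * S.Xx t x)
        - 2 * (S.w t x * S.T t x))) t := by
    refine hasDerivAt_integral_unit (F := fun t x => S.T t x ^ 2 + S.X t x ^ 2)
      (F' := fun t x => 2 * (S.Tx t x * S.X t x + S.T t x * S.Xx t x)
        - 2 * (S.w t x * S.T t x)) (by fun_prop) (by fun_prop)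
      (fun t ht x hx => ?_) (by simp) (by simp) ht
    refine (((S.T_t t ht x hx).pow 2).add ((S.X_t t ht x hx).pow 2)).congr_deriv ?_
    push_cast
    ring
  have h2 : ∫ x in (0:ℝ)..1, (S.Tx t x * S.X t x + S.T t x * S.Xx t x) =
      S.T t 1 * S.X t 1 - S.T t 0 * S.X t 0 :=
    integral_unit_eq_sub (G := fun x => S.T t x * S.X t x) (by fun_prop) (by fun_prop)
      fun x hx => (S.T_x t ht x hx).mul (S.X_x t ht x hx)
  rw [intervalIntegral.integral_sub (Continuous.intervalIntegrable (by fun_prop) _ _)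
    (Continuous.intervalIntegrable (by fun_prop) _ _), intervalIntegral.integral_const_mul,
    intervalIntegral.integral_const_mul, h2, S.T_one t ht.le, S.T_zero t ht.le] at h1
  refine ((((h1.div_const 2).add (((S.ode₁ t ht).pow 2).div_const (2 * β₁))).add
    ((((S.ode₂ t ht).pow 2).const_mul α₂).div_const (2 * β₁))).add
    (((S.ode₃ t ht).pow 2).div_const (2 * μ₁))).congr_deriv ?_
  rw [damp]
  push_cast
  field_simp
  ring

lemma hasDerivAt_crossTerm (hβ : 0 < β₁) (hμ : 0 < μ₁) (c : ℝ) {t : ℝ} (ht : 0 < t) :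
    HasDerivAt (S.crossTerm l c)
      ((∫ x in (0:ℝ)..1, S.potentialRate l c t x * S.T t x) - S.P l 2 t
        - (∫ x in (0:ℝ)..1, S.potential l c t x * S.w t x)
        + (∫ s in (0:ℝ)..1, l.φ s * S.v t s) * S.η₂ t + c / β₁ * S.η₁ t ^ 2
        - c * α₂ / β₁ * S.η₂ t ^ 2 + S.potentialRate l c t 0 * S.ζ t / μ₁
        - γ₁ / μ₁ * (S.potential l c t 0 * S.ζ t)) t := by
  have hX := S.cont_X
  have hT := S.cont_T
  have hv := S.cont_v
  have hXx := S.cont_Xx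
  have hw := S.cont_w
  have hφ := l.cont_φ
  have hz := S.cont_potential l c
  have hz' := S.cont_potentialRate l c
  have h1 : HasDerivAt (fun t => ∫ x in (0:ℝ)..1, S.potential l c t x * S.T t x)
      (∫ x in (0:ℝ)..1, (S.potentialRate l c t x * S.T t x
        + S.potential l c t x * (S.Xx t x - S.w t x))) t :=
    hasDerivAt_integral_unit (F := fun t x => S.potential l c t x * S.T t x)
      (F' := fun t x => S.potentialRate l c t x * S.T t x
        + S.potential l c t x * (S.Xx t x - S.w t x)) (by fun_prop) (by fun_prop)
      (fun t ht x hx => (S.hasDerivAt_potential l c ht (Ioo_subset_Icc_self hx)).mul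
        (S.T_t t ht x hx)) (by simp) (by simp) ht
  have hY : Continuous fun x => ∫ s in (0:ℝ)..x, l.φ s * S.v t s :=
    intervalIntegral.continuous_primitive
      (fun a b => Continuous.intervalIntegrable (by fun_prop) a b) 0
  have h2 := integral_unit_eq_sub
    (G := fun x => S.potential l c t x * S.X t x + (∫ s in (0:ℝ)..x, l.φ s * S.v t s) * S.v t x)
    (G' := fun x => S.potential l c t x * S.Xx t x + l.φ x * S.v t x ^ 2)
    (by fun_prop) (by fun_prop) fun x hx => by
      have d1 : HasDerivAt (S.potential l c t) (-∫ s in (0:ℝ)..x, l.φ s * S.v t s) x :=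
        (hasDerivAt_doublePrimitive hφ (S.continuous_v t) x).const_add _
      have d2 : HasDerivAt (fun x => ∫ s in (0:ℝ)..x, l.φ s * S.v t s) (l.φ x * S.v t x) x :=
        (hφ.mul (S.continuous_v t)).integral_hasStrictDerivAt 0 x |>.hasDerivAt
      refine ((d1.mul (S.X_x t ht x hx)).add (d2.mul (S.v_x t ht.le x hx))).congr_deriv ?_
      ring
  have e1 : S.potential l c t 1 = c * S.η₂ t := by
    simp [potential, doublePrimitive]
  rw [intervalIntegral.integral_add (Continuous.intervalIntegrable (by fun_prop) _ _)
    (Continuous.intervalIntegrable (by fun_prop) _ _), ← P_two] at h2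
  simp only [intervalIntegral.integral_same, zero_mul, add_zero, e1, S.v_one t ht.le] at h2
  have e2 : ∫ x in (0:ℝ)..1, (S.potentialRate l c t x * S.T t x
        + S.potential l c t x * (S.Xx t x - S.w t x)) =
      (∫ x in (0:ℝ)..1, S.potentialRate l c t x * S.T t x)
        + (∫ x in (0:ℝ)..1, S.potential l c t x * S.Xx t x)
        - ∫ x in (0:ℝ)..1, S.potential l c t x * S.w t x := by
    rw [← intervalIntegral.integral_add, ← intervalIntegral.integral_sub]
    · exact intervalIntegral.integral_congr fun x _ => by ring
    all_goals exact Continuous.intervalIntegrable (by fun_prop) _ _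
  rw [e2, eq_sub_of_add_eq h2] at h1
  refine ((h1.add ((((S.ode₁ t ht).mul (S.ode₂ t ht)).add
    ((((S.ode₂ t ht).pow 2).const_mul α₁).div_const 2)).const_mul (c / β₁))).add
    (((S.hasDerivAt_potential l c ht (by simp : (0:ℝ) ∈ Icc (0:ℝ) 1)).mul
      (S.ode₃ t ht)).div_const μ₁)).congr_deriv ?_
  push_cast
  field_simp
  ring

end FirstOrderSystem

namespace FirstOrderSystem

variable {q : ℝ → ℝ} {α₁ α₂ β₁ γ₁ μ₁ : ℝ} (S : FirstOrderSystem q α₁ α₂ β₁ γ₁ μ₁)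
  (l : Localizer q)

/-- The square of the energy norm. -/
noncomputable def sqNorm (t : ℝ) : ℝ := S.W 2 t + S.η₁ t ^ 2 + S.η₂ t ^ 2 + S.ζ t ^ 2

lemma sqNorm_nonneg (t : ℝ) : 0 ≤ S.sqNorm t := by
  have := S.W_nonneg 2 t
  unfold sqNorm
  positivity

lemma v_sq_le {t x : ℝ} (ht : 0 ≤ t) (hx : x ∈ Icc (0:ℝ) 1) :
    S.v t x ^ 2 ≤ 2 * S.η₂ t ^ 2 + S.W 2 t := by
  have hX := S.continuous_X t
  have hT := S.continuous_T t
  have hv := S.continuous_v t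
  have h1 : ∫ y in x..1, S.X t y = S.η₂ t - S.v t x := by
    rw [← S.v_one t ht]
    exact intervalIntegral.integral_eq_sub_of_hasDerivAt_of_le hx.2 hv.continuousOn
      (fun y hy => S.v_x t ht y ⟨hx.1.trans_lt hy.1, hy.2⟩) (hX.intervalIntegrable _ _)
  have h2 : |∫ y in x..1, S.X t y| ≤ ∫ y in (0:ℝ)..1, |S.X t y| :=
    (intervalIntegral.abs_integral_le_integral_abs hx.2).trans
      (intervalIntegral.integral_mono_interval hx.1 hx.2 le_rfl
        (Filter.Eventually.of_forall fun _ => abs_nonneg _) (hX.abs.intervalIntegrable _ _))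
  have h3 : (∫ y in (0:ℝ)..1, |S.X t y|) ^ 2 ≤ ∫ y in (0:ℝ)..1, S.X t y ^ 2 := by
    simpa using sq_integral_abs_le (φ := fun _ => 1) continuous_const hX (fun _ => zero_le_one)
      (by simp)
  have h4 : ∫ y in (0:ℝ)..1, S.X t y ^ 2 ≤ ∫ y in (0:ℝ)..1, (S.T t y ^ 2 + S.X t y ^ 2) :=
    integral_unit_mono (by fun_prop) (by fun_prop) fun y _ => by nlinarith [sq_nonneg (S.T t y)]
  have h5 := sq_le_sq' (by linarith [(abs_le.1 h2).1]) (abs_le.1 h2).2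
  rw [h1] at h5
  rw [W_two]
  nlinarith [sq_nonneg (2 * S.η₂ t - S.v t x)]

lemma P_two_le {t : ℝ} (ht : 0 ≤ t) : S.P l 2 t ≤ 2 * S.η₂ t ^ 2 + S.W 2 t := by
  have hv := S.continuous_v t
  have hφ := l.cont_φ
  calc S.P l 2 t = ∫ x in (0:ℝ)..1, l.φ x * S.v t x ^ 2 := S.P_two l t
    _ ≤ ∫ x in (0:ℝ)..1, l.φ x * (2 * S.η₂ t ^ 2 + S.W 2 t) :=
        integral_unit_mono (by fun_prop) (by fun_prop) fun x hx =>
          mul_le_mul_of_nonneg_left (S.v_sq_le ht hx) (l.φ_nonneg x)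
    _ = _ := by rw [intervalIntegral.integral_mul_const, l.integral_φ, one_mul]

lemma mul_le_eps {k : ℝ} (hk : 0 < k) (a b : ℝ) :
    a * b ≤ k * b ^ 2 + 1 / (4 * k) * a ^ 2 := by
  have : k * b ^ 2 + 1 / (4 * k) * a ^ 2 - a * b = k * (b - a / (2 * k)) ^ 2 := by
    field_simp
    ring
  linarith [mul_nonneg hk.le (sq_nonneg (b - a / (2 * k)))]

lemma integral_potentialRate_mul_le {δ Z c t : ℝ} (hδ : 0 < δ)
    (hZ : ∀ x ∈ Icc (0:ℝ) 1, S.potentialRate l c t x ^ 2 ≤ Z) :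
    ∫ x in (0:ℝ)..1, S.potentialRate l c t x * S.T t x ≤ δ * S.W 2 t + 1 / (4 * δ) * Z := by
  have hz := S.cont_potentialRate l c
  have hT := S.continuous_T t
  have hX := S.continuous_X t
  have h : ∫ x in (0:ℝ)..1, S.potentialRate l c t x * S.T t x ≤
      ∫ x in (0:ℝ)..1, (δ * (S.T t x ^ 2 + S.X t x ^ 2) + 1 / (4 * δ) * Z) :=
    integral_unit_mono (by fun_prop) (by fun_prop) fun x hx => by
      have h1 := mul_le_eps hδ (S.potentialRate l c t x) (S.T t x)
      have h2 := mul_le_mul_of_nonneg_left (hZ x hx) (by positivity : 0 ≤ 1 / (4 * δ))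
      linarith [mul_nonneg hδ.le (sq_nonneg (S.X t x))]
  rw [intervalIntegral.integral_add (Continuous.intervalIntegrable (by fun_prop) _ _)
    (by simp), intervalIntegral.integral_const_mul, intervalIntegral.integral_const] at h
  simp only [sub_zero, one_smul] at h
  have h0 := mul_nonneg hδ.le (S.W_nonneg 2 t)
  rw [W_two] at h0 ⊢
  linarith

lemma neg_integral_potential_mul_le {ε Z c t : ℝ} (hε : 0 < ε) (ht : 0 < t)
    (hZ : ∀ x ∈ Icc (0:ℝ) 1, S.potential l c t x ^ 2 ≤ Z) :
    -∫ x in (0:ℝ)..1, S.potential l c t x * S.w t x ≤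
      ε * Z + 1 / (4 * ε) * (l.Q * S.damp t) := by
  have hz := S.cont_potential l c
  have hw := S.continuous_w t
  have h : ∫ x in (0:ℝ)..1, -(S.potential l c t x * S.w t x) ≤
      ∫ x in (0:ℝ)..1, (ε * Z + 1 / (4 * ε) * S.w t x ^ 2) :=
    integral_unit_mono (by fun_prop) (by fun_prop) fun x hx => by
      have h1 := mul_le_eps hε (-S.w t x) (S.potential l c t x)
      have h2 := mul_le_mul_of_nonneg_left (hZ x hx) hε.le
      rw [neg_sq] at h1
      linarith
  rw [intervalIntegral.integral_add (by simp)
    (Continuous.intervalIntegrable (by fun_prop) _ _), intervalIntegral.integral_const,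
    intervalIntegral.integral_const_mul, intervalIntegral.integral_neg] at h
  simp only [sub_zero, one_smul] at h
  have h3 := mul_le_mul_of_nonneg_left (S.integral_w_sq_le l ht)
    (by positivity : 0 ≤ 1 / (4 * ε))
  linarith

lemma exists_crossTerm_deriv_le (hα₂ : 0 < α₂) (hβ : 0 < β₁) (hγ : 0 < γ₁) (hμ : 0 < μ₁)
    {δ : ℝ} (hδ : 0 < δ) : ∃ C ≥ 0, ∀ S : FirstOrderSystem q α₁ α₂ β₁ γ₁ μ₁, ∀ t > 0, ∃ K',
      HasDerivAt (S.crossTerm l (2 * β₁ / α₂)) K' t ∧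
      K' ≤ δ * S.W 2 t - S.P l 2 t / 2 - S.η₂ t ^ 2 / 2
        + C * (S.η₁ t ^ 2 + S.ζ t ^ 2 + S.damp t) := by
  obtain ⟨c, hc⟩ : ∃ a, a = 2 * β₁ / α₂ := ⟨_, rfl⟩
  rw [← hc]
  have hc0 : 0 < c := by rw [hc]; positivity
  obtain ⟨ε, hε⟩ : ∃ a, a = 1 / (16 * (c ^ 2 + 1)) := ⟨_, rfl⟩
  have hε0 : 0 < ε := by rw [hε]; positivity
  have hεc : 16 * ε * c ^ 2 + 16 * ε = 1 := by rw [hε]; field_simp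
  have hQ := l.Q_nonneg
  have hκ := l.κ_nonneg
  obtain ⟨g, hg⟩ : ∃ a, a = γ₁ / μ₁ := ⟨_, rfl⟩
  have hg0 : 0 < g := by rw [hg]; positivity
  refine ⟨1 / (4 * δ) * (2 * c ^ 2 + 2 * l.κ) + 1 / (4 * ε) * l.Q + c / β₁
    + (2 * c ^ 2 + 2 * l.κ + 1 / μ₁ ^ 2) + g ^ 2 / (4 * ε), by positivity,
    fun S t ht => ⟨_, S.hasDerivAt_crossTerm l hβ hμ c ht, ?_⟩⟩
  have hD := S.damp_nonneg l ht
  have zero_mem : (0:ℝ) ∈ Icc (0:ℝ) 1 := by simp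
  obtain ⟨Z, hZ⟩ : ∃ a, a = 2 * c ^ 2 * S.η₂ t ^ 2 + 2 * S.P l 2 t := ⟨_, rfl⟩
  obtain ⟨Z', hZ'⟩ : ∃ a, a = 2 * c ^ 2 * S.η₁ t ^ 2 + 2 * (l.κ * S.damp t) := ⟨_, rfl⟩
  have hzz := fun x (hx : x ∈ Icc (0:ℝ) 1) => (S.potential_sq_le l c t hx).trans_eq hZ.symm
  have hzz' := fun x (hx : x ∈ Icc (0:ℝ) 1) =>
    (S.potentialRate_sq_le l c ht hx).trans_eq hZ'.symm
  have i1 := S.integral_potentialRate_mul_le l hδ hzz'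
  have i2 := S.neg_integral_potential_mul_le l hε0 ht hzz
  have i3 : (∫ s in (0:ℝ)..1, l.φ s * S.v t s) * S.η₂ t ≤ S.P l 2 t / 4 + S.η₂ t ^ 2 := by
    have h := sq_primitive_le l.cont_φ (S.continuous_v t) l.φ_nonneg l.integral_φ
      (by simp : (1:ℝ) ∈ Icc (0:ℝ) 1)
    rw [← P_two] at h
    have := mul_le_eps one_pos (∫ s in (0:ℝ)..1, l.φ s * S.v t s) (S.η₂ t)
    linarith
  have i4 : S.potentialRate l c t 0 * S.ζ t / μ₁ ≤ Z' + 1 / μ₁ ^ 2 * S.ζ t ^ 2 := by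
    have h1 := hzz' 0 zero_mem
    have h2 := mul_le_eps one_pos (S.potentialRate l c t 0) (S.ζ t / μ₁)
    have e : (S.ζ t / μ₁) ^ 2 = 1 / μ₁ ^ 2 * S.ζ t ^ 2 := by ring
    rw [e] at h2
    have : 0 ≤ S.potentialRate l c t 0 ^ 2 := sq_nonneg _
    rw [mul_div_assoc]
    linarith
  have i5 : -(g * (S.potential l c t 0 * S.ζ t)) ≤ ε * Z + g ^ 2 / (4 * ε) * S.ζ t ^ 2 := by
    have h1 := mul_le_mul_of_nonneg_left (hzz 0 zero_mem) hε0.le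
    have h2 := mul_le_eps hε0 (-(g * S.ζ t)) (S.potential l c t 0)
    have e : 1 / (4 * ε) * (-(g * S.ζ t)) ^ 2 = g ^ 2 / (4 * ε) * S.ζ t ^ 2 := by ring
    rw [e] at h2
    linarith
  have e6 : c * α₂ / β₁ = 2 := by rw [hc]; field_simp
  have i7 : 2 * (ε * Z) ≤ S.P l 2 t / 4 + S.η₂ t ^ 2 / 2 := by
    have hP := S.P_nonneg l 2 t
    have h1 : 16 * ε * c ^ 2 ≤ 1 := by linarith
    have h2 : 16 * ε ≤ 1 := by linarith [mul_nonneg hε0.le (sq_nonneg c)]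
    rw [hZ]
    linarith [mul_le_mul_of_nonneg_right h1 (sq_nonneg (S.η₂ t)),
      mul_le_mul_of_nonneg_right h2 hP, sq_nonneg (S.η₂ t)]
  rw [e6, ← hg]
  obtain ⟨R, hR⟩ : ∃ R, R = S.η₁ t ^ 2 + S.ζ t ^ 2 + S.damp t := ⟨_, rfl⟩
  rw [← hR]
  have r1 : S.η₁ t ^ 2 ≤ R := by nlinarith [sq_nonneg (S.ζ t)]
  have r2 : S.ζ t ^ 2 ≤ R := by nlinarith [sq_nonneg (S.η₁ t)]
  have r3 : S.damp t ≤ R := by nlinarith [sq_nonneg (S.η₁ t), sq_nonneg (S.ζ t)]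
  have r4 : Z' ≤ (2 * c ^ 2 + 2 * l.κ) * R := by
    have h1 := mul_le_mul_of_nonneg_left r1 (by positivity : 0 ≤ 2 * c ^ 2)
    have h2 := mul_le_mul_of_nonneg_left r3 (by positivity : 0 ≤ 2 * l.κ)
    rw [hZ']
    linarith
  have r5 := mul_le_mul_of_nonneg_left r4 (by positivity : 0 ≤ 1 / (4 * δ))
  have r6 := mul_le_mul_of_nonneg_left r3 (by positivity : 0 ≤ 1 / (4 * ε) * l.Q)
  have r7 := mul_le_mul_of_nonneg_left r1 (by positivity : 0 ≤ c / β₁)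
  have r8 := mul_le_mul_of_nonneg_left r2 (by positivity : 0 ≤ 1 / μ₁ ^ 2)
  have r9 := mul_le_mul_of_nonneg_left r2 (by positivity : 0 ≤ g ^ 2 / (4 * ε))
  linarith

lemma exists_abs_crossTerm_le (hα₁ : 0 < α₁) (hβ : 0 < β₁) (hμ : 0 < μ₁) {c : ℝ} (hc : 0 ≤ c) :
    ∃ C ≥ 0, ∀ S : FirstOrderSystem q α₁ α₂ β₁ γ₁ μ₁, ∀ t ≥ 0,
      |S.crossTerm l c t| ≤ C * S.sqNorm t := by
  refine ⟨(2 * c ^ 2 + 6) / 2 + c / β₁ * (1 + α₁) + (2 * c ^ 2 + 6 + 1) / μ₁, by positivity,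
    fun S t ht => ?_⟩
  have hz := S.cont_potential l c
  have hT := S.continuous_T t
  have hX := S.continuous_X t
  have hW := S.W_nonneg 2 t
  have hP := S.P_two_le l ht
  set e := S.sqNorm t with he
  rw [sqNorm] at he
  have e1 : S.η₁ t ^ 2 ≤ e := by nlinarith [sq_nonneg (S.ζ t), sq_nonneg (S.η₂ t)]
  have e2 : S.η₂ t ^ 2 ≤ e := by nlinarith [sq_nonneg (S.ζ t), sq_nonneg (S.η₁ t)]
  have e3 : S.ζ t ^ 2 ≤ e := by nlinarith [sq_nonneg (S.η₂ t), sq_nonneg (S.η₁ t)]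
  have e4 : S.W 2 t + S.η₂ t ^ 2 ≤ e := by nlinarith [sq_nonneg (S.ζ t), sq_nonneg (S.η₁ t)]
  have hZ : ∀ x ∈ Icc (0:ℝ) 1, S.potential l c t x ^ 2 ≤ (2 * c ^ 2 + 4) * e := fun x hx => by
    have h1 := S.potential_sq_le l c t hx
    have h2 := mul_le_mul_of_nonneg_left e2 (by positivity : 0 ≤ 2 * c ^ 2)
    linarith
  have i1 : |∫ x in (0:ℝ)..1, S.potential l c t x * S.T t x| ≤ (2 * c ^ 2 + 6) / 2 * e := by
    refine (intervalIntegral.abs_integral_le_integral_abs zero_le_one).trans ?_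
    have h : ∫ x in (0:ℝ)..1, |S.potential l c t x * S.T t x| ≤
        ∫ x in (0:ℝ)..1, ((2 * c ^ 2 + 4) / 2 * e + (S.T t x ^ 2 + S.X t x ^ 2)) :=
      integral_unit_mono (by fun_prop) (by fun_prop) fun x hx => by
        have h1 := hZ x hx
        rw [abs_le]
        constructor <;> nlinarith [sq_nonneg (S.potential l c t x + S.T t x),
          sq_nonneg (S.potential l c t x - S.T t x), sq_nonneg (S.T t x), sq_nonneg (S.X t x)]
    rw [intervalIntegral.integral_add (by simp)
      (Continuous.intervalIntegrable (by fun_prop) _ _), intervalIntegral.integral_const] at h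
    simp only [sub_zero, one_smul] at h
    have := S.W_two t
    nlinarith [sq_nonneg (S.η₂ t)]
  have i2 : |c / β₁ * (S.η₁ t * S.η₂ t + α₁ * S.η₂ t ^ 2 / 2)| ≤ c / β₁ * (1 + α₁) * e := by
    rw [abs_mul, abs_of_nonneg (by positivity : 0 ≤ c / β₁), mul_assoc]
    refine mul_le_mul_of_nonneg_left (abs_le.2 ?_) (by positivity)
    have h1 := mul_le_mul_of_nonneg_left e2 hα₁.le
    have h2 := mul_nonneg hα₁.le (sq_nonneg (S.η₂ t))
    constructor <;> nlinarith [sq_nonneg (S.η₁ t + S.η₂ t), sq_nonneg (S.η₁ t - S.η₂ t)]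
  have i3 : |S.potential l c t 0 * S.ζ t / μ₁| ≤ (2 * c ^ 2 + 6 + 1) / μ₁ * e := by
    have h1 := hZ 0 (by simp)
    rw [abs_div, abs_of_pos hμ, div_mul_eq_mul_div]
    gcongr
    refine abs_le.2 ?_
    have h2 : 0 ≤ c ^ 2 * e := mul_nonneg (sq_nonneg c) ((sq_nonneg _).trans e2)
    constructor <;> nlinarith [sq_nonneg (S.potential l c t 0 + S.ζ t),
      sq_nonneg (S.potential l c t 0 - S.ζ t)]
  have := abs_add_three (∫ x in (0:ℝ)..1, S.potential l c t x * S.T t x)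
    (c / β₁ * (S.η₁ t * S.η₂ t + α₁ * S.η₂ t ^ 2 / 2)) (S.potential l c t 0 * S.ζ t / μ₁)
  rw [crossTerm]
  linarith

lemma exists_energy_bounds (hα₂ : 0 < α₂) (hβ : 0 < β₁) (hμ : 0 < μ₁) :
    ∃ k > 0, ∃ C ≥ 0, ∀ S : FirstOrderSystem q α₁ α₂ β₁ γ₁ μ₁, ∀ t,
      k * S.sqNorm t ≤ S.energy t ∧ S.energy t ≤ C * S.sqNorm t := by
  set a := 1 / (2 * β₁) with ha
  set b := α₂ / (2 * β₁) with hb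
  set d := 1 / (2 * μ₁) with hd
  have ha0 : 0 < a := by positivity
  have hb0 : 0 < b := by positivity
  have hd0 : 0 < d := by positivity
  refine ⟨min (1 / 4) (min a (min b d)), by positivity, 1 / 4 + a + b + d, by positivity,
    fun S t => ?_⟩
  have hW := S.W_nonneg 2 t
  have e : S.energy t = 1 / 4 * S.W 2 t + a * S.η₁ t ^ 2 + b * S.η₂ t ^ 2 + d * S.ζ t ^ 2 := by
    rw [energy, W_two, ha, hb, hd]
    ring
  have k1 : min (1 / 4) (min a (min b d)) ≤ 1 / 4 := min_le_left _ _
  have k2 : min (1 / 4) (min a (min b d)) ≤ a := (min_le_right _ _).trans (min_le_left _ _)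
  have k3 : min (1 / 4) (min a (min b d)) ≤ b :=
    (min_le_right _ _).trans ((min_le_right _ _).trans (min_le_left _ _))
  have k4 : min (1 / 4) (min a (min b d)) ≤ d :=
    (min_le_right _ _).trans ((min_le_right _ _).trans (min_le_right _ _))
  rw [e, sqNorm]
  constructor
  · simp only [mul_add]
    gcongr
  · simp only [mul_add]
    gcongr <;> linarith

/-- Exponential stability in the energy norm. -/
lemma exists_sqNorm_decay (l : Localizer q) (hα₁ : 0 < α₁) (hα₂ : 0 < α₂) (hβ : 0 < β₁) (hγ : 0 < γ₁)
    (hμ : 0 < μ₁) : ∃ C ≥ 0, ∃ ν > 0, ∀ S : FirstOrderSystem q α₁ α₂ β₁ γ₁ μ₁, ∀ t ≥ 0,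
      S.sqNorm t ≤ C * S.sqNorm 0 * Real.exp (-ν * t) := by
  obtain ⟨N, hN, C₀, hC₀, hV'⟩ := exists_V_deriv_le (α₁ := α₁) (α₂ := α₂) (β₁ := β₁) (γ₁ := γ₁)
    (μ₁ := μ₁) l (le_refl (2:ℝ))
  obtain ⟨C₁, hC₁, hV⟩ := exists_V_bounds (α₁ := α₁) (α₂ := α₂) (β₁ := β₁) (γ₁ := γ₁)
    (μ₁ := μ₁) l (le_refl (2:ℝ))
  obtain ⟨A, hA⟩ : ∃ a, a = 2 * C₀ + 2 := ⟨_, rfl⟩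
  have hA0 : 0 < A := by rw [hA]; positivity
  obtain ⟨C₂, hC₂, hK'⟩ := exists_crossTerm_deriv_le (α₁ := α₁) l hα₂ hβ hγ hμ
    (δ := 1 / (4 * A)) (by positivity)
  obtain ⟨C₃, hC₃, hK⟩ := exists_abs_crossTerm_le (α₂ := α₂) (γ₁ := γ₁) l hα₁ hβ hμ
    (c := 2 * β₁ / α₂) (by positivity)
  obtain ⟨k, hk, C₄, hC₄, hE⟩ := exists_energy_bounds (q := q) (α₁ := α₁) (γ₁ := γ₁) hα₂ hβ hμ
  obtain ⟨m, hm⟩ : ∃ a, a = min 1 (min (α₁ / β₁) (γ₁ / μ₁)) := ⟨_, rfl⟩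
  have hm0 : 0 < m := by rw [hm]; positivity
  have m1 : m ≤ 1 := hm ▸ min_le_left _ _
  have m2 : m ≤ α₁ / β₁ := hm ▸ (min_le_right _ _).trans (min_le_left _ _)
  have m3 : m ≤ γ₁ / μ₁ := hm ▸ (min_le_right _ _).trans (min_le_right _ _)
  obtain ⟨CV, hCV⟩ : ∃ a, a = N + 4 + 2 * C₁ := ⟨_, rfl⟩
  set B := (C₀ + A * C₂ + 1) / m + (CV + A * C₃ + 1) / k with hB
  have hCV0 : 0 ≤ CV := by rw [hCV]; positivity
  have hB0 : 0 ≤ B := by rw [hB]; positivity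
  have hBm : C₀ + A * C₂ + 1 ≤ B * m := by
    have : 0 ≤ (CV + A * C₃ + 1) / k * m := by positivity
    rw [hB, add_mul, div_mul_cancel₀ _ hm0.ne']
    linarith
  have hBk : CV + A * C₃ + 1 ≤ B * k := by
    have : 0 ≤ (C₀ + A * C₂ + 1) / m * k := by positivity
    rw [hB, add_mul, div_mul_cancel₀ _ hk.ne']
    linarith
  obtain ⟨M, hM⟩ : ∃ a, a = CV + A * C₃ + B * C₄ + 1 := ⟨_, rfl⟩
  have hM0 : 0 < M := by rw [hM]; positivity
  refine ⟨M, hM0.le, 1 / (4 * M), by positivity, fun S t ht => ?_⟩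
  choose! dV hdV hdV' using hV' S
  choose! dK hdK hdK' using hK' S
  set L := fun t => S.V l 2 N t + A * S.crossTerm l (2 * β₁ / α₂) t + B * S.energy t with hL
  have bounds : ∀ t ≥ 0, S.sqNorm t ≤ L t ∧ L t ≤ M * S.sqNorm t := by
    intro t ht
    have he := S.sqNorm_nonneg t
    have h1 := hV N hN S t
    have h2 := abs_le.1 (hK S t ht)
    have h3 := hE S t
    have hP := mul_le_mul_of_nonneg_left (S.P_two_le l ht) hC₁
    have hW : S.W 2 t ≤ S.sqNorm t := by
      rw [sqNorm]
      nlinarith [sq_nonneg (S.η₁ t), sq_nonneg (S.η₂ t), sq_nonneg (S.ζ t)]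
    have hWη : 2 * S.η₂ t ^ 2 + S.W 2 t ≤ 2 * S.sqNorm t := by
      have := S.W_nonneg 2 t
      rw [sqNorm]
      nlinarith [sq_nonneg (S.η₁ t), sq_nonneg (S.η₂ t), sq_nonneg (S.ζ t)]
    have hP' := hP.trans (mul_le_mul_of_nonneg_left hWη hC₁)
    have hV1 : -(CV * S.sqNorm t) ≤ S.V l 2 N t := by
      have := mul_nonneg (by linarith : 0 ≤ N + 4) he
      have := S.W_nonneg 2 t
      rw [hCV]
      linarith [h1.1]
    have hV2 : S.V l 2 N t ≤ CV * S.sqNorm t := by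
      have := mul_le_mul_of_nonneg_left hW (by linarith : 0 ≤ N + 4)
      rw [hCV]
      linarith [h1.2]
    have g1 := mul_le_mul_of_nonneg_left h2.1 hA0.le
    have g2 := mul_le_mul_of_nonneg_left h2.2 hA0.le
    have g3 := mul_le_mul_of_nonneg_left h3.1 hB0
    have g4 := mul_le_mul_of_nonneg_left h3.2 hB0
    have g5 := mul_le_mul_of_nonneg_right hBk he
    simp only [hL, hM]
    constructor <;> linarith
  have hLc : Continuous L := by
    have h1 := S.continuous_V l (le_refl (2:ℝ)) N
    have h2 := S.continuous_crossTerm l (2 * β₁ / α₂)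
    have h3 := S.continuous_energy
    fun_prop
  have hdL : ∀ t > 0, HasDerivAt L (dV t + A * dK t
      + B * -(S.damp t + α₁ / β₁ * S.η₁ t ^ 2 + γ₁ / μ₁ * S.ζ t ^ 2)) t := fun t ht =>
    ((hdV t ht).add ((hdK t ht).const_mul A)).add ((S.hasDerivAt_energy hβ hμ ht).const_mul B)
  have key := exp_decay_of_deriv_le (ν := 1 / (4 * M)) (ν' := 1 / (4 * M) + 1) (K := 0)
    (by linarith) le_rfl hLc.continuousOn hdL (fun t ht => ?_) ht
  · rw [zero_div, add_zero] at key
    refine (bounds t ht).1.trans (key.trans ?_)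
    gcongr
    exact (bounds 0 le_rfl).2
  · have hLM : 1 / (4 * M) * L t ≤ 1 / 4 * S.sqNorm t := by
      have := mul_le_mul_of_nonneg_left (bounds t ht.le).2 (by positivity : 0 ≤ 1 / (4 * M))
      refine this.trans (le_of_eq ?_)
      field_simp
    have h1 := hdV' t ht
    have h2 := mul_le_mul_of_nonneg_left (hdK' t ht) hA0.le
    simp only [Real.rpow_two, sq_abs] at h1
    have hD := S.damp_nonneg l ht
    obtain ⟨R, hR⟩ : ∃ R, R = S.η₁ t ^ 2 + S.ζ t ^ 2 + S.damp t := ⟨_, rfl⟩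
    rw [← hR] at h2
    have hR0 : 0 ≤ R := by rw [hR]; positivity
    have h3 : m * R ≤ S.damp t + α₁ / β₁ * S.η₁ t ^ 2 + γ₁ / μ₁ * S.ζ t ^ 2 := by
      have a1 := mul_le_mul_of_nonneg_right m1 hD
      have a2 := mul_le_mul_of_nonneg_right m2 (sq_nonneg (S.η₁ t))
      have a3 := mul_le_mul_of_nonneg_right m3 (sq_nonneg (S.ζ t))
      rw [hR]
      linarith
    have h4 := mul_le_mul_of_nonneg_left h3 hB0
    have h5 := mul_le_mul_of_nonneg_right hBm hR0
    have h6 : A * (1 / (4 * A) * S.W 2 t) = S.W 2 t / 4 := by field_simp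
    have hP := S.P_nonneg l 2 t
    have h7 : A * (S.P l 2 t / 2) = C₀ * S.P l 2 t + S.P l 2 t := by rw [hA]; ring
    have h8 : A * (S.η₂ t ^ 2 / 2) = C₀ * S.η₂ t ^ 2 + S.η₂ t ^ 2 := by rw [hA]; ring
    have h9 := mul_nonneg hC₀ (sq_nonneg (S.η₂ t))
    have h10 := mul_nonneg hC₀ hD
    have h11 : S.sqNorm t = S.W 2 t + S.η₁ t ^ 2 + S.η₂ t ^ 2 + S.ζ t ^ 2 := rfl
    have hx := sq_nonneg (S.η₁ t)
    have hy := sq_nonneg (S.η₂ t)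
    have hz := sq_nonneg (S.ζ t)
    simp only [zero_mul, add_zero]
    have h12 : C₀ * R = C₀ * (S.η₁ t ^ 2 + S.ζ t ^ 2 + S.damp t) := by rw [hR]
    linarith

end FirstOrderSystem

lemma sq_rpow_half (p a : ℝ) : (a ^ 2) ^ (p / 2) = |a| ^ p := by
  rw [← sq_abs, ← Real.rpow_two, ← Real.rpow_mul (abs_nonneg a)]
  ring_nf

lemma abs_rpow_le_of_sq_le {p a b : ℝ} (hp : 0 ≤ p) (h : a ^ 2 ≤ b) : |a| ^ p ≤ b ^ (p / 2) := by
  rw [← sq_rpow_half]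
  exact Real.rpow_le_rpow (sq_nonneg a) h (by positivity)

lemma sq_le_add_abs_rpow {p s : ℝ} (hp : 2 ≤ p) (hs : 0 < s) (g : ℝ) :
    g ^ 2 ≤ s ^ 2 + s ^ 2 * (|g| ^ p / s ^ p) := by
  obtain ⟨y, hy⟩ : ∃ y, y = |g| / s := ⟨_, rfl⟩
  have hy0 : 0 ≤ y := by rw [hy]; positivity
  have h : y ^ 2 ≤ 1 + y ^ p := by
    rcases le_total y 1 with h | h
    · have := Real.rpow_nonneg hy0 p
      nlinarith
    · rw [← Real.rpow_two]
      linarith [Real.rpow_le_rpow_of_exponent_le h hp]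
  have e : |g| = s * y := by rw [hy]; field_simp
  rw [← Real.div_rpow (abs_nonneg g) hs.le, ← hy, ← sq_abs, e]
  nlinarith [mul_le_mul_of_nonneg_left h (sq_nonneg s)]

namespace FirstOrderSystem

variable {q : ℝ → ℝ} {α₁ α₂ β₁ γ₁ μ₁ : ℝ} (S : FirstOrderSystem q α₁ α₂ β₁ γ₁ μ₁)
  (l : Localizer q)

/-- The `p`-th power of a norm equivalent to the one defining the `L^p` energy. -/
noncomputable def normPow (p t : ℝ) : ℝ :=
  S.W p t + |S.η₁ t| ^ p + |S.η₂ t| ^ p + |S.ζ t| ^ p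

lemma normPow_nonneg (p t : ℝ) : 0 ≤ S.normPow p t := by
  have := S.W_nonneg p t
  unfold normPow
  positivity

lemma sqNorm_rpow_le {p : ℝ} (hp : 2 ≤ p) (t : ℝ) :
    S.sqNorm t ^ (p / 2) ≤ 6 ^ (p / 2) * S.normPow p t := by
  rw [← div_le_iff₀' (by positivity)]
  refine le_of_forall_gt_imp_ge_of_dense fun n hn => ?_
  have hn0 : 0 < n := (S.normPow_nonneg p t).trans_lt hn
  have hp0 : p ≠ 0 := by linarith
  obtain ⟨s, hs⟩ : ∃ s, s = n ^ (1 / p) := ⟨_, rfl⟩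
  have hs0 : 0 < s := by rw [hs]; positivity
  have hsp : s ^ p = n := by rw [hs, ← Real.rpow_mul hn0.le, one_div_mul_cancel hp0, Real.rpow_one]
  have hp00 : 0 ≤ p := by linarith
  have cρ : Continuous (S.ρ t) := (S.continuous_X t).add (S.continuous_T t)
  have cξ : Continuous (S.ξ t) := (S.continuous_X t).sub (S.continuous_T t)
  have key := sq_le_add_abs_rpow hp hs0
  have hW : S.W 2 t ≤ 2 * s ^ 2 + s ^ 2 * (S.W p t / n) := by
    have h : S.W 2 t ≤
        ∫ x in (0:ℝ)..1, (2 * s ^ 2 + s ^ 2 / n * (|S.ρ t x| ^ p + |S.ξ t x| ^ p)) :=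
      integral_unit_mono (by simp only [Real.rpow_two]; fun_prop)
        (by fun_prop (disch := assumption)) fun x _ => by
        have h1 := key (S.ρ t x)
        have h2 := key (S.ξ t x)
        rw [hsp] at h1 h2
        simp only [Real.rpow_two, sq_abs]
        refine (add_le_add h1 h2).trans (le_of_eq ?_)
        ring
    rw [intervalIntegral.integral_add (by simp)
      (Continuous.intervalIntegrable (by fun_prop (disch := assumption)) _ _),
      intervalIntegral.integral_const, intervalIntegral.integral_const_mul] at h
    simp only [sub_zero, one_smul] at h
    refine h.trans (le_of_eq ?_)
    rw [W]
    ring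
  have h6 : S.sqNorm t ≤ 6 * s ^ 2 := by
    have h1 := key (S.η₁ t)
    have h2 := key (S.η₂ t)
    have h3 := key (S.ζ t)
    rw [hsp] at h1 h2 h3
    have h4 : S.normPow p t / n ≤ 1 := (div_le_one hn0).2 hn.le
    have h5 := mul_le_mul_of_nonneg_left h4 (sq_nonneg s)
    have e : s ^ 2 * (S.normPow p t / n) = s ^ 2 * (S.W p t / n) + s ^ 2 * (|S.η₁ t| ^ p / n)
        + s ^ 2 * (|S.η₂ t| ^ p / n) + s ^ 2 * (|S.ζ t| ^ p / n) := by rw [normPow]; ring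
    rw [sqNorm]
    linarith
  rw [div_le_iff₀' (by positivity)]
  calc S.sqNorm t ^ (p / 2) ≤ (6 * s ^ 2) ^ (p / 2) :=
        Real.rpow_le_rpow (S.sqNorm_nonneg t) h6 (by linarith)
    _ = _ := by rw [Real.mul_rpow (by norm_num) (sq_nonneg s), sq_rpow_half, abs_of_pos hs0, hsp]

lemma v_abs_rpow_le {p t x : ℝ} (hp : 0 ≤ p) (ht : 0 ≤ t) (hx : x ∈ Icc (0:ℝ) 1) :
    |S.v t x| ^ p ≤ 2 ^ (p / 2) * S.sqNorm t ^ (p / 2) := by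
  rw [← Real.mul_rpow (by norm_num) (S.sqNorm_nonneg t)]
  refine abs_rpow_le_of_sq_le hp ((S.v_sq_le ht hx).trans ?_)
  have := S.W_nonneg 2 t
  rw [sqNorm]
  linarith [sq_nonneg (S.η₁ t), sq_nonneg (S.ζ t)]

lemma P_le {p t : ℝ} (hp : 2 ≤ p) (ht : 0 ≤ t) :
    S.P l p t ≤ 2 ^ (p / 2) * S.sqNorm t ^ (p / 2) := by
  have hφ := l.cont_φ
  have c2 : Continuous fun x => l.φ x * |S.v t x| ^ p :=
    (S.cont_moment l hp).comp (by fun_prop : Continuous fun x : ℝ => (t, x))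
  calc S.P l p t ≤ ∫ x in (0:ℝ)..1, l.φ x * (2 ^ (p / 2) * S.sqNorm t ^ (p / 2)) :=
        integral_unit_mono c2 (by fun_prop) fun x hx =>
          mul_le_mul_of_nonneg_left (S.v_abs_rpow_le (by linarith) ht hx) (l.φ_nonneg x)
    _ = _ := by rw [intervalIntegral.integral_mul_const, l.integral_φ, one_mul]

/-- Exponential stability in `L^p`. -/
lemma exists_normPow_decay (l : Localizer q) {p : ℝ} (hp : 2 ≤ p) (hα₁ : 0 < α₁)
    (hα₂ : 0 < α₂) (hβ : 0 < β₁) (hγ : 0 < γ₁) (hμ : 0 < μ₁) : ∃ C ≥ 0, ∃ ν > 0,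
      ∀ S : FirstOrderSystem q α₁ α₂ β₁ γ₁ μ₁, ∀ t ≥ 0,
        S.normPow p t ≤ C * S.normPow p 0 * Real.exp (-ν * t) ∧
        ∀ x ∈ Icc (0:ℝ) 1, |S.v t x| ^ p ≤ C * S.normPow p 0 * Real.exp (-ν * t) := by
  obtain ⟨N, hN, C₀, hC₀, hV'⟩ := exists_V_deriv_le (α₁ := α₁) (α₂ := α₂) (β₁ := β₁) (γ₁ := γ₁)
    (μ₁ := μ₁) l hp
  obtain ⟨C₁, hC₁, hV⟩ := exists_V_bounds (α₁ := α₁) (α₂ := α₂) (β₁ := β₁) (γ₁ := γ₁)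
    (μ₁ := μ₁) l hp
  obtain ⟨C₂, hC₂, ν₂, hν₂, hsq⟩ := exists_sqNorm_decay l hα₁ hα₂ hβ hγ hμ
  obtain ⟨ν₁, hν₁e⟩ : ∃ a, a = ν₂ * (p / 2) := ⟨_, rfl⟩
  have hν₁ : 0 < ν₁ := by rw [hν₁e]; positivity
  obtain ⟨D, hD⟩ : ∃ a, a = C₂ ^ (p / 2) * 6 ^ (p / 2) := ⟨_, rfl⟩
  have hD0 : 0 ≤ D := by rw [hD]; positivity
  obtain ⟨b, hb⟩ : ∃ b : ℝ, b = 2 ^ (p / 2) := ⟨_, rfl⟩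
  have hb0 : 0 ≤ b := by rw [hb]; positivity
  have hN4 : 0 < N + 4 := by linarith
  obtain ⟨ν, hν⟩ : ∃ a, a = min (1 / (2 * (N + 4))) (ν₁ / 2) := ⟨_, rfl⟩
  have hν0 : 0 < ν := by rw [hν]; positivity
  have hνN : ν * (N + 4) ≤ 1 / 2 := by
    calc ν * (N + 4) ≤ 1 / (2 * (N + 4)) * (N + 4) := by
          gcongr
          exact hν ▸ min_le_left _ _
      _ = 1 / 2 := by field_simp
  have hνν : ν < ν₁ := by
    have : ν ≤ ν₁ / 2 := hν ▸ min_le_right _ _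
    linarith
  obtain ⟨K, hK⟩ : ∃ a, a = (C₀ * (b + 2) + ν * (C₁ * b)) * D := ⟨_, rfl⟩
  have hK0 : 0 ≤ K := by rw [hK]; positivity
  obtain ⟨M, hM⟩ : ∃ a, a = N + 4 + C₁ * b * D + K / (ν₁ - ν) := ⟨_, rfl⟩
  have hM0 : 0 ≤ M := by
    have : 0 < ν₁ - ν := sub_pos.2 hνν
    rw [hM]
    positivity
  refine ⟨M + C₁ * b * D + 3 * D + b * D, by positivity, ν, hν0, fun S t ht => ?_⟩
  obtain ⟨n, hn⟩ : ∃ a, a = S.normPow p 0 := ⟨_, rfl⟩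
  have hn0 : 0 ≤ n := hn ▸ S.normPow_nonneg p 0
  have hg : ∀ t ≥ 0, S.sqNorm t ^ (p / 2) ≤ D * n * Real.exp (-ν₁ * t) := by
    intro t ht
    have h0 := S.sqNorm_nonneg 0
    calc S.sqNorm t ^ (p / 2) ≤ (C₂ * S.sqNorm 0 * Real.exp (-ν₂ * t)) ^ (p / 2) :=
          Real.rpow_le_rpow (S.sqNorm_nonneg t) (hsq S t ht) (by linarith)
      _ = C₂ ^ (p / 2) * S.sqNorm 0 ^ (p / 2) * Real.exp (-ν₁ * t) := by
          rw [Real.mul_rpow (by positivity) (Real.exp_pos _).le, Real.mul_rpow hC₂ h0,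
            ← Real.exp_mul, hν₁e]
          ring_nf
      _ ≤ C₂ ^ (p / 2) * (6 ^ (p / 2) * n) * Real.exp (-ν₁ * t) := by
          gcongr
          exact hn ▸ S.sqNorm_rpow_le hp 0
      _ = _ := by rw [hD]; ring
  have hg' : ∀ t ≥ 0, S.sqNorm t ^ (p / 2) ≤ D * n * Real.exp (-ν * t) := fun t ht =>
    (hg t ht).trans (by gcongr)
  have hcomp : ∀ a t, a ^ 2 ≤ S.sqNorm t → |a| ^ p ≤ S.sqNorm t ^ (p / 2) := fun a t h =>
    abs_rpow_le_of_sq_le (by linarith) h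
  have hη₁ : ∀ t, |S.η₁ t| ^ p ≤ S.sqNorm t ^ (p / 2) := fun t => hcomp _ _ (by
    have := S.W_nonneg 2 t
    rw [sqNorm]
    linarith [sq_nonneg (S.η₂ t), sq_nonneg (S.ζ t)])
  have hη₂ : ∀ t, |S.η₂ t| ^ p ≤ S.sqNorm t ^ (p / 2) := fun t => hcomp _ _ (by
    have := S.W_nonneg 2 t
    rw [sqNorm]
    linarith [sq_nonneg (S.η₁ t), sq_nonneg (S.ζ t)])
  have hζ : ∀ t, |S.ζ t| ^ p ≤ S.sqNorm t ^ (p / 2) := fun t => hcomp _ _ (by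
    have := S.W_nonneg 2 t
    rw [sqNorm]
    linarith [sq_nonneg (S.η₁ t), sq_nonneg (S.η₂ t)])
  have hP : ∀ t ≥ 0, S.P l p t ≤ b * S.sqNorm t ^ (p / 2) := fun t ht => hb ▸ S.P_le l hp ht
  choose! dV hdV hdV' using hV' S
  have key := exp_decay_of_deriv_le hνν (K := K * n) (by positivity)
    (S.continuous_V l hp N).continuousOn hdV (fun t ht => ?_) ht
  · have hexp := Real.exp_pos (-ν * t)
    have h0 : S.V l p N 0 ≤ (N + 4 + C₁ * b * D) * n := by
      have h1 := (hV N hN S 0).2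
      have h2 := mul_le_mul_of_nonneg_left ((hP 0 le_rfl).trans
        (mul_le_mul_of_nonneg_left (hg 0 le_rfl) hb0)) hC₁
      have h3 : S.W p 0 ≤ n := by
        have a1 : 0 ≤ |S.η₁ 0| ^ p := by positivity
        have a2 : 0 ≤ |S.η₂ 0| ^ p := by positivity
        have a3 : 0 ≤ |S.ζ 0| ^ p := by positivity
        rw [hn, normPow]
        linarith
      have h4 := mul_le_mul_of_nonneg_left h3 hN4.le
      rw [mul_zero, Real.exp_zero] at h2
      linarith
    have hVt : S.V l p N t ≤ M * n * Real.exp (-ν * t) := by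
      refine key.trans (mul_le_mul_of_nonneg_right ?_ hexp.le)
      have : K * n / (ν₁ - ν) = K / (ν₁ - ν) * n := by ring
      rw [hM, this]
      linarith
    obtain ⟨E, hE⟩ : ∃ a, a = n * Real.exp (-ν * t) := ⟨_, rfl⟩
    have hE0 : 0 ≤ E := by rw [hE]; positivity
    have hgE : S.sqNorm t ^ (p / 2) ≤ D * E := by
      rw [hE, ← mul_assoc]
      exact hg' t ht
    rw [mul_assoc, ← hE] at hVt
    rw [← hn, mul_assoc, ← hE]
    have hPt := mul_le_mul_of_nonneg_left ((hP t ht).trans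
      (mul_le_mul_of_nonneg_left hgE hb0)) hC₁
    have hW := (hV N hN S t).1
    have p1 : 0 ≤ M * E := by positivity
    have p2 : 0 ≤ C₁ * b * D * E := by positivity
    have p3 : 0 ≤ D * E := by positivity
    have p4 : 0 ≤ b * D * E := by positivity
    constructor
    · have h1 := hη₁ t
      have h2 := hη₂ t
      have h3 := hζ t
      rw [normPow]
      linarith
    · intro x hx
      have h1 := S.v_abs_rpow_le (p := p) (by linarith) ht hx
      rw [← hb] at h1
      have h2 := mul_le_mul_of_nonneg_left hgE hb0
      linarith
  · have h1 := hdV' t ht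
    have h2 := (hV N hN S t).2
    have h3 := mul_le_mul_of_nonneg_right hνN (S.W_nonneg p t)
    have h4 := mul_le_mul_of_nonneg_left h2 hν0.le
    have h5 := mul_le_mul_of_nonneg_left (hP t ht.le) hC₀
    have h6 := mul_le_mul_of_nonneg_left (hP t ht.le) (mul_nonneg hν0.le hC₁)
    have h7 := mul_le_mul_of_nonneg_left (hη₁ t) hC₀
    have h8 := mul_le_mul_of_nonneg_left (hζ t) hC₀
    have h9 := mul_le_mul_of_nonneg_left (hg t ht.le)
      (by positivity : 0 ≤ C₀ * (b + 2) + ν * (C₁ * b))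
    have e : K * n * Real.exp (-ν₁ * t) =
        (C₀ * (b + 2) + ν * (C₁ * b)) * (D * n * Real.exp (-ν₁ * t)) := by rw [hK]; ring
    rw [e]
    linarith

end FirstOrderSystem

section Extension

open Topology Filter

/-- The closed half-strip of nonnegative times and positions in the unit interval. -/
def halfStrip : Set (ℝ × ℝ) := Ici 0 ×ˢ Icc 0 1

/-- The retraction of the real line onto the unit interval. -/
noncomputable def clampUnit (x : ℝ) : ℝ := max 0 (min 1 x)

lemma continuous_clampUnit : Continuous clampUnit := by
  unfold clampUnit
  fun_prop

lemma clampUnit_mem (x : ℝ) : clampUnit x ∈ Icc (0:ℝ) 1 := by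
  simp [clampUnit]

lemma clampUnit_of_mem {x : ℝ} (hx : x ∈ Icc (0:ℝ) 1) : clampUnit x = x := by
  simp [clampUnit, hx.1, hx.2]

/-- The extension of a function on the half-strip to the plane. -/
noncomputable def stripExtend (f : ℝ → ℝ → ℝ) (t x : ℝ) : ℝ := f (max t 0) (clampUnit x)

lemma stripExtend_of_mem {f : ℝ → ℝ → ℝ} {t x : ℝ} (ht : 0 ≤ t) (hx : x ∈ Icc (0:ℝ) 1) :
    stripExtend f t x = f t x := by
  rw [stripExtend, max_eq_left ht, clampUnit_of_mem hx]

lemma continuous_stripExtend {f : ℝ → ℝ → ℝ}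
    (hf : ContinuousOn (fun z : ℝ × ℝ => f z.1 z.2) halfStrip) :
    Continuous (Function.uncurry (stripExtend f)) := by
  have := continuous_clampUnit
  exact hf.comp_continuous (f := fun z : ℝ × ℝ => (max z.1 0, clampUnit z.2)) (by fun_prop)
    fun z => ⟨mem_Ici.2 (le_max_right _ _), clampUnit_mem _⟩

lemma hasDerivAt_stripExtend_time {f : ℝ → ℝ → ℝ} {f' t x : ℝ} (ht : 0 < t)
    (hx : x ∈ Icc (0:ℝ) 1) (h : HasDerivAt (fun s => f s x) f' t) :
    HasDerivAt (fun s => stripExtend f s x) f' t := by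
  refine h.congr_of_eventuallyEq ?_
  filter_upwards [Ioi_mem_nhds ht] with s hs using stripExtend_of_mem (le_of_lt hs) hx

lemma hasDerivAt_stripExtend_space {f : ℝ → ℝ → ℝ} {f' t x : ℝ} (ht : 0 ≤ t)
    (hx : x ∈ Ioo (0:ℝ) 1) (h : HasDerivAt (f t) f' x) :
    HasDerivAt (stripExtend f t) f' x := by
  refine h.congr_of_eventuallyEq ?_
  filter_upwards [Icc_mem_nhds hx.1 hx.2] with y hy using stripExtend_of_mem ht hy

lemma halfStrip_mem_nhds {t x : ℝ} (ht : 0 < t) (hx : x ∈ Ioo (0:ℝ) 1) :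
    halfStrip ∈ 𝓝 (t, x) :=
  prod_mem_nhds (Ici_mem_nhds ht) (Icc_mem_nhds hx.1 hx.2)

/-- The derivative of `f` along `z`, computed within the half-strip. -/
noncomputable def stripDeriv (f : ℝ → ℝ → ℝ) (z : ℝ × ℝ) (t x : ℝ) : ℝ :=
  fderivWithin ℝ (fun p : ℝ × ℝ => f p.1 p.2) halfStrip (t, x) z

lemma continuousOn_stripDeriv {f : ℝ → ℝ → ℝ}
    (hf : ContDiffOn ℝ 1 (fun p : ℝ × ℝ => f p.1 p.2) halfStrip) (z : ℝ × ℝ) :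
    ContinuousOn (fun p : ℝ × ℝ => stripDeriv f z p.1 p.2) halfStrip :=
  (hf.continuousOn_fderivWithin ((uniqueDiffOn_Ici 0).prod (uniqueDiffOn_Icc zero_lt_one))
    le_rfl).clm_apply continuousOn_const

lemma hasFDerivAt_of_contDiffOn_halfStrip {f : ℝ → ℝ → ℝ} {t x : ℝ}
    (hf : ContDiffOn ℝ 1 (fun p : ℝ × ℝ => f p.1 p.2) halfStrip) (ht : 0 < t)
    (hx : x ∈ Ioo (0:ℝ) 1) :
    HasFDerivAt (fun p : ℝ × ℝ => f p.1 p.2)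
      (fderivWithin ℝ (fun p : ℝ × ℝ => f p.1 p.2) halfStrip (t, x)) (t, x) :=
  ((hf.differentiableOn one_ne_zero) _ (mem_of_mem_nhds (halfStrip_mem_nhds ht hx))
    ).hasFDerivWithinAt.hasFDerivAt (halfStrip_mem_nhds ht hx)

lemma hasDerivAt_stripDeriv_time {f : ℝ → ℝ → ℝ} {t x : ℝ}
    (hf : ContDiffOn ℝ 1 (fun p : ℝ × ℝ => f p.1 p.2) halfStrip) (ht : 0 < t)
    (hx : x ∈ Ioo (0:ℝ) 1) : HasDerivAt (fun s => f s x) (stripDeriv f (1, 0) t x) t :=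
  (hasFDerivAt_of_contDiffOn_halfStrip hf ht hx).comp_hasDerivAt (f := fun s => (s, x)) t
    ((hasDerivAt_id t).prodMk (hasDerivAt_const t x))

lemma hasDerivAt_stripDeriv_space {f : ℝ → ℝ → ℝ} {t x : ℝ}
    (hf : ContDiffOn ℝ 1 (fun p : ℝ × ℝ => f p.1 p.2) halfStrip) (ht : 0 < t)
    (hx : x ∈ Ioo (0:ℝ) 1) : HasDerivAt (f t) (stripDeriv f (0, 1) t x) x :=
  (hasFDerivAt_of_contDiffOn_halfStrip hf ht hx).comp_hasDerivAt (f := fun y => (t, y)) x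
    ((hasDerivAt_const x t).prodMk (hasDerivAt_id x))

/-- Symmetry of the mixed second derivatives, in terms of the first partial derivatives. -/
lemma mixed_partials_eq {u ut ux : ℝ → ℝ → ℝ} {z : ℝ × ℝ} {Dt Dx : ℝ × ℝ →L[ℝ] ℝ}
    (ht : ∀ᶠ y in 𝓝 z, HasDerivAt (fun s => u s y.2) (ut y.1 y.2) y.1)
    (hx : ∀ᶠ y in 𝓝 z, HasDerivAt (u y.1) (ux y.1 y.2) y.2)
    (ct : ∀ᶠ y in 𝓝 z, ContinuousAt (fun p : ℝ × ℝ => ut p.1 p.2) y)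
    (cx : ∀ᶠ y in 𝓝 z, ContinuousAt (fun p : ℝ × ℝ => ux p.1 p.2) y)
    (hDt : HasFDerivAt (fun p : ℝ × ℝ => ut p.1 p.2) Dt z)
    (hDx : HasFDerivAt (fun p : ℝ × ℝ => ux p.1 p.2) Dx z) : Dt (0, 1) = Dx (1, 0) := by
  have hu : ∀ᶠ y in 𝓝 z, HasFDerivAt (Function.uncurry u)
      (ut y.1 y.2 • ContinuousLinearMap.fst ℝ ℝ ℝ + ux y.1 y.2 • ContinuousLinearMap.snd ℝ ℝ ℝ)
      y := by
    filter_upwards [ht.eventually_nhds, hx.eventually_nhds, ct, cx] with y hty hxy cty cxy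
    have := (hasStrictFDerivAt_uncurry_coprod (𝕜 := ℝ) (u := y) (f := u)
      (f₁ := fun a b => ContinuousLinearMap.toSpanSingleton ℝ (ut a b))
      (f₂ := fun a b => ContinuousLinearMap.toSpanSingleton ℝ (ux a b))
      (hty.mono fun v hv => hv.hasFDerivAt) (hxy.mono fun v hv => hv.hasFDerivAt)
      ((ContinuousLinearMap.toSpanSingletonCLE (𝕜 := ℝ) (E := ℝ)).continuous.continuousAt.comp cty)
      ((ContinuousLinearMap.toSpanSingletonCLE (𝕜 := ℝ) (E := ℝ)).continuous.continuousAt.comp cxy)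
      ).hasFDerivAt
    refine HasFDerivAt.congr_fderiv this ?_
    ext <;> simp [Function.HasUncurry.uncurry]
  have hu' := (hDt.smul_const (ContinuousLinearMap.fst ℝ ℝ ℝ)).add
    (hDx.smul_const (ContinuousLinearMap.snd ℝ ℝ ℝ))
  simpa using second_derivative_symmetric_of_eventually hu hu' (0, 1) (1, 0)

end Extension

namespace ClassicalSolutionS

variable {q : ℝ → ℝ} {α₁ α₂ β₁ γ₁ μ₁ : ℝ} (sol : ClassicalSolutionS (fun _ => 1) q α₁ α₂ β₁ γ₁ μ₁)

/-- The displacement relative to the equilibrium. -/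
def displacement (t x : ℝ) : ℝ := sol.u t x - (sol.u 0 1 - sol.η₂ 0)

lemma displacement_one {t : ℝ} (ht : 0 ≤ t) : sol.displacement t 1 = sol.η₂ t := by
  have h : ∀ s ≥ 0, HasDerivAt (fun s => sol.u s 1 - sol.η₂ s) 0 s := fun s hs => by
    have := (sol.hu_t s hs 1 (by simp)).sub (sol.hode2 s hs)
    rwa [sol.hbc1 s hs, sub_self] at this
  have := constant_of_has_deriv_right_zero (a := 0) (b := t)
    (fun s hs => (h s hs.1).continuousAt.continuousWithinAt)
    (fun s hs => (h s hs.1).hasDerivWithinAt) t ⟨ht, le_rfl⟩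
  rw [displacement]
  linarith

lemma displacement_eq {t x : ℝ} (ht : 0 ≤ t) (hx : x ∈ Icc (0:ℝ) 1) :
    sol.displacement t x = sol.η₂ t + ∫ y in (1:ℝ)..x, stripExtend sol.ux t y := by
  have hc := continuous_stripExtend sol.hux_C1.continuousOn
  have hs : uIcc 1 x ⊆ Icc (0:ℝ) 1 := by
    rw [uIcc_of_ge hx.2]
    exact Icc_subset_Icc_left hx.1
  rw [intervalIntegral.integral_eq_sub_of_hasDerivAt (f := sol.displacement t)
    (fun y hy => ?_) (Continuous.intervalIntegrable (by fun_prop) _ _), sol.displacement_one ht]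
  · ring
  · rw [stripExtend_of_mem ht (hs hy)]
    exact (sol.hu_x t ht y (hs hy)).sub_const _

lemma continuous_displacement : Continuous (Function.uncurry (stripExtend sol.displacement)) := by
  have hc := continuous_stripExtend sol.hux_C1.continuousOn
  have hp := intervalIntegral.continuous_parametric_primitive_of_continuous (a₀ := 1)
    (μ := volume) hc
  refine continuous_stripExtend ?_
  refine (ContinuousOn.add (f := fun z : ℝ × ℝ => sol.η₂ z.1)
    (sol.hη₂C1.continuousOn.comp continuousOn_fst fun z hz => hz.1) hp.continuousOn).congr
    fun z hz => sol.displacement_eq hz.1 hz.2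

lemma stripDeriv_ux_time {t x : ℝ} (ht : 0 < t) (hx : x ∈ Ioo (0:ℝ) 1) :
    stripDeriv sol.ut (0, 1) t x = stripDeriv sol.ux (1, 0) t x := by
  have hO : Ioi (0:ℝ) ×ˢ Ioo (0:ℝ) 1 ∈ nhds (t, x) :=
    prod_mem_nhds (Ioi_mem_nhds ht) (Ioo_mem_nhds hx.1 hx.2)
  refine mixed_partials_eq (u := sol.u) (ut := sol.ut) (ux := sol.ux) ?_ ?_ ?_ ?_
    (hasFDerivAt_of_contDiffOn_halfStrip sol.hut_C1 ht hx)
    (hasFDerivAt_of_contDiffOn_halfStrip sol.hux_C1 ht hx)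
  all_goals filter_upwards [hO] with y hy
  · exact sol.hu_t _ (mem_Ici.2 (le_of_lt hy.1)) _ (Ioo_subset_Icc_self hy.2)
  · exact sol.hu_x _ (mem_Ici.2 (le_of_lt hy.1)) _ (Ioo_subset_Icc_self hy.2)
  · exact (hasFDerivAt_of_contDiffOn_halfStrip sol.hut_C1 hy.1 hy.2).continuousAt
  · exact (hasFDerivAt_of_contDiffOn_halfStrip sol.hux_C1 hy.1 hy.2).continuousAt

lemma hasDerivAt_comp_max {f : ℝ → ℝ} {f' t : ℝ} (ht : 0 < t) (h : HasDerivAt f f' t) :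
    HasDerivAt (fun s => f (max s 0)) f' t := by
  refine h.congr_of_eventuallyEq ?_
  filter_upwards [Ioi_mem_nhds ht] with s hs
  rw [max_eq_left (le_of_lt hs)]

lemma continuous_comp_max {f : ℝ → ℝ} (h : ContinuousOn f (Ici 0)) :
    Continuous fun s => f (max s 0) :=
  h.comp_continuous (by fun_prop) fun _ => mem_Ici.2 (le_max_right _ _)

/-- The first-order system solved by a classical solution. -/
noncomputable def toFirstOrderSystem : FirstOrderSystem q α₁ α₂ β₁ γ₁ μ₁ where
  T := stripExtend sol.ut
  X := stripExtend sol.ux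
  v := stripExtend sol.displacement
  w := stripExtend fun t x => stripDeriv sol.ux (0, 1) t x - stripDeriv sol.ut (1, 0) t x
  Tx := stripExtend (stripDeriv sol.ut (0, 1))
  Xx := stripExtend (stripDeriv sol.ux (0, 1))
  η₁ t := sol.η₁ (max t 0)
  η₂ t := sol.η₂ (max t 0)
  ζ t := sol.ζ₁ (max t 0)
  cont_T := continuous_stripExtend sol.hut_C1.continuousOn
  cont_X := continuous_stripExtend sol.hux_C1.continuousOn
  cont_v := sol.continuous_displacement
  cont_w := continuous_stripExtend
    ((continuousOn_stripDeriv sol.hux_C1 _).sub (continuousOn_stripDeriv sol.hut_C1 _))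
  cont_Tx := continuous_stripExtend (continuousOn_stripDeriv sol.hut_C1 _)
  cont_Xx := continuous_stripExtend (continuousOn_stripDeriv sol.hux_C1 _)
  cont_η₁ := continuous_comp_max sol.hη₁C1.continuousOn
  cont_η₂ := continuous_comp_max sol.hη₂C1.continuousOn
  cont_ζ := continuous_comp_max sol.hζ₁C1.continuousOn
  T_t t ht x hx := by
    have hx' := Ioo_subset_Icc_self hx
    simp only [stripExtend_of_mem (le_of_lt ht) hx', sub_sub_cancel]
    exact hasDerivAt_stripExtend_time ht hx' (hasDerivAt_stripDeriv_time sol.hut_C1 ht hx)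
  X_t t ht x hx := by
    have hx' := Ioo_subset_Icc_self hx
    rw [stripExtend_of_mem (le_of_lt ht) hx', sol.stripDeriv_ux_time ht hx]
    exact hasDerivAt_stripExtend_time ht hx' (hasDerivAt_stripDeriv_time sol.hux_C1 ht hx)
  v_t t ht x hx := by
    have hx' := Ioo_subset_Icc_self hx
    rw [stripExtend_of_mem (le_of_lt ht) hx']
    exact hasDerivAt_stripExtend_time ht hx' ((sol.hu_t t (le_of_lt ht) x hx').sub_const _)
  T_x t ht x hx := by
    rw [stripExtend_of_mem (le_of_lt ht) (Ioo_subset_Icc_self hx)]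
    exact hasDerivAt_stripExtend_space (le_of_lt ht) hx
      (hasDerivAt_stripDeriv_space sol.hut_C1 ht hx)
  X_x t ht x hx := by
    rw [stripExtend_of_mem (le_of_lt ht) (Ioo_subset_Icc_self hx)]
    exact hasDerivAt_stripExtend_space (le_of_lt ht) hx
      (hasDerivAt_stripDeriv_space sol.hux_C1 ht hx)
  v_x t ht x hx := by
    rw [stripExtend_of_mem ht (Ioo_subset_Icc_self hx)]
    exact hasDerivAt_stripExtend_space ht hx
      ((sol.hu_x t ht x (Ioo_subset_Icc_self hx)).sub_const _)
  damping t ht := by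
    have ht' : t ∈ Ici (0:ℝ) := le_of_lt ht
    filter_upwards [sol.haux t ht', sol.hPDE t ht', ae_restrict_mem measurableSet_Ioo]
      with x haux hPDE hx
    have hx' := Ioo_subset_Icc_self hx
    simp only [one_mul] at haux
    rw [stripExtend_of_mem ht' hx', stripExtend_of_mem ht' hx',
      (hasDerivAt_stripDeriv_space sol.hux_C1 ht hx).unique haux,
      (hasDerivAt_stripDeriv_time sol.hut_C1 ht hx).unique (sol.hu_tt t ht' x hx')]
    linarith
  T_one t ht := by rw [stripExtend_of_mem ht (by simp), sol.hbc1 t ht, max_eq_left ht]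
  T_zero t ht := by rw [stripExtend_of_mem ht (by simp), sol.hbc0 t ht, max_eq_left ht]
  v_one t ht := by rw [stripExtend_of_mem ht (by simp), sol.displacement_one ht, max_eq_left ht]
  ode₁ t ht := by
    rw [stripExtend_of_mem (le_of_lt ht) (by simp), max_eq_left (le_of_lt ht)]
    exact hasDerivAt_comp_max ht (sol.hode1 t (le_of_lt ht))
  ode₂ t ht := by
    rw [max_eq_left (le_of_lt ht)]
    exact hasDerivAt_comp_max ht (sol.hode2 t (le_of_lt ht))
  ode₃ t ht := by
    rw [stripExtend_of_mem (le_of_lt ht) (by simp), max_eq_left (le_of_lt ht)]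
    exact hasDerivAt_comp_max ht (sol.hode3 t (le_of_lt ht))

end ClassicalSolutionS

lemma abs_add_rpow_le_two_rpow_mul {p : ℝ} (hp : 0 ≤ p) (a b : ℝ) :
    |a + b| ^ p ≤ 2 ^ p * (|a| ^ p + |b| ^ p) := by
  have h : |a + b| ≤ 2 * max |a| |b| := by
    linarith [abs_add_le a b, le_max_left |a| |b|, le_max_right |a| |b|]
  have h0 : 0 ≤ max |a| |b| := (abs_nonneg a).trans (le_max_left _ _)
  refine (Real.rpow_le_rpow (abs_nonneg _) h hp).trans ?_
  rw [Real.mul_rpow zero_le_two h0]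
  gcongr
  have ha : 0 ≤ |a| ^ p := by positivity
  have hb : 0 ≤ |b| ^ p := by positivity
  rcases max_choice |a| |b| with h | h <;> rw [h] <;> linarith

namespace ClassicalSolutionS

variable {q : ℝ → ℝ} {α₁ α₂ β₁ γ₁ μ₁ : ℝ} (sol : ClassicalSolutionS (fun _ => 1) q α₁ α₂ β₁ γ₁ μ₁)

lemma integral_eq_stripExtend {p t : ℝ} (ht : 0 ≤ t) :
    ∫ x in (0:ℝ)..1, (|sol.ut t x| ^ p + |sol.ux t x| ^ p) =
      ∫ x in (0:ℝ)..1, (|stripExtend sol.ut t x| ^ p + |stripExtend sol.ux t x| ^ p) := by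
  refine intervalIntegral.integral_congr fun x hx => ?_
  rw [uIcc_of_le zero_le_one] at hx
  simp only [stripExtend_of_mem ht hx]

lemma integral_le_W {p t : ℝ} (hp : 0 ≤ p) (ht : 0 ≤ t) :
    ∫ x in (0:ℝ)..1, (|sol.ut t x| ^ p + |sol.ux t x| ^ p) ≤
      2 * 2 ^ p * sol.toFirstOrderSystem.W p t := by
  have cT := sol.toFirstOrderSystem.continuous_T t
  have cX := sol.toFirstOrderSystem.continuous_X t
  rw [sol.integral_eq_stripExtend ht, FirstOrderSystem.W, ← intervalIntegral.integral_const_mul]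
  change ∫ x in (0:ℝ)..1, (|sol.toFirstOrderSystem.T t x| ^ p +
    |sol.toFirstOrderSystem.X t x| ^ p) ≤ _
  simp only [FirstOrderSystem.ρ, FirstOrderSystem.ξ]
  refine integral_unit_mono (by fun_prop (disch := assumption))
    (by fun_prop (disch := assumption)) fun x _ => ?_
  generalize sol.toFirstOrderSystem.T t x = a
  generalize sol.toFirstOrderSystem.X t x = b
  have h1 := abs_add_rpow_le_two_rpow_mul hp (b + a) (b - a)
  have h2 := abs_add_rpow_le_two_rpow_mul hp (b + a) (-(b - a))
  have h3 : ∀ c : ℝ, |c| ^ p ≤ |2 * c| ^ p := fun c => by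
    refine Real.rpow_le_rpow (abs_nonneg c) ?_ hp
    rw [abs_mul, abs_two]
    linarith [abs_nonneg c]
  rw [abs_neg, show b + a + -(b - a) = 2 * a by ring] at h2
  rw [show b + a + (b - a) = 2 * b by ring] at h1
  linarith [h3 a, h3 b]

lemma W_le_integral {p t : ℝ} (hp : 0 ≤ p) (ht : 0 ≤ t) :
    sol.toFirstOrderSystem.W p t ≤
      2 * 2 ^ p * ∫ x in (0:ℝ)..1, (|sol.ut t x| ^ p + |sol.ux t x| ^ p) := by
  have cT := sol.toFirstOrderSystem.continuous_T t
  have cX := sol.toFirstOrderSystem.continuous_X t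
  rw [sol.integral_eq_stripExtend ht, FirstOrderSystem.W, ← intervalIntegral.integral_const_mul]
  change _ ≤ ∫ x in (0:ℝ)..1, 2 * 2 ^ p * (|sol.toFirstOrderSystem.T t x| ^ p +
    |sol.toFirstOrderSystem.X t x| ^ p)
  simp only [FirstOrderSystem.ρ, FirstOrderSystem.ξ]
  refine integral_unit_mono (by fun_prop (disch := assumption))
    (by fun_prop (disch := assumption)) fun x _ => ?_
  generalize sol.toFirstOrderSystem.T t x = a
  generalize sol.toFirstOrderSystem.X t x = b
  have h1 := abs_add_rpow_le_two_rpow_mul hp b a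
  have h2 := abs_add_rpow_le_two_rpow_mul hp b (-a)
  rw [abs_neg, ← sub_eq_add_neg] at h2
  linarith

lemma integral_nonneg (p t : ℝ) :
    0 ≤ ∫ x in (0:ℝ)..1, (|sol.ut t x| ^ p + |sol.ux t x| ^ p) :=
  intervalIntegral.integral_nonneg zero_le_one fun x _ => by positivity

lemma normPow_eq {p t : ℝ} (ht : 0 ≤ t) : sol.toFirstOrderSystem.normPow p t =
    sol.toFirstOrderSystem.W p t + |sol.η₁ t| ^ p + |sol.η₂ t| ^ p + |sol.ζ₁ t| ^ p := by
  change sol.toFirstOrderSystem.W p t + |sol.η₁ (max t 0)| ^ p + |sol.η₂ (max t 0)| ^ p +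
    |sol.ζ₁ (max t 0)| ^ p = _
  rw [max_eq_left ht]

lemma energyLp_le_normPow {p t : ℝ} (hp : 0 < p) (hα₂ : 0 < α₂) (hβ₁ : 0 < β₁) (hμ₁ : 0 < μ₁)
    (ht : 0 ≤ t) : energyLp p sol t ≤
      (1 / p * (2 * 2 ^ p) + 1 / (p * β₁) + α₂ / (p * β₁) + 1 / (p * μ₁)) *
        sol.toFirstOrderSystem.normPow p t := by
  rw [energyLp, sol.normPow_eq ht]
  have hW := sol.toFirstOrderSystem.W_nonneg p t
  have h := mul_le_mul_of_nonneg_left (sol.integral_le_W hp.le ht) (by positivity : 0 ≤ 1 / p)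
  rw [← mul_assoc] at h
  have hη₁ : 0 ≤ |sol.η₁ t| ^ p := by positivity
  have hη₂ : 0 ≤ |sol.η₂ t| ^ p := by positivity
  have hζ₁ : 0 ≤ |sol.ζ₁ t| ^ p := by positivity
  have k₀ : 0 ≤ 1 / p * (2 * 2 ^ p) := by positivity
  have k₁ : 0 ≤ 1 / (p * β₁) := by positivity
  have k₂ : 0 ≤ α₂ / (p * β₁) := by positivity
  have k₃ : 0 ≤ 1 / (p * μ₁) := by positivity
  simp only [add_mul, mul_add]
  linarith [mul_nonneg k₀ hη₁, mul_nonneg k₀ hη₂, mul_nonneg k₀ hζ₁, mul_nonneg k₁ hW,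
    mul_nonneg k₁ hη₂, mul_nonneg k₁ hζ₁, mul_nonneg k₂ hW, mul_nonneg k₂ hη₁,
    mul_nonneg k₂ hζ₁, mul_nonneg k₃ hW, mul_nonneg k₃ hη₁, mul_nonneg k₃ hη₂]

lemma normPow_le_energyLp {p t : ℝ} (hp : 0 < p) (hα₂ : 0 < α₂) (hβ₁ : 0 < β₁) (hμ₁ : 0 < μ₁)
    (ht : 0 ≤ t) : sol.toFirstOrderSystem.normPow p t ≤
      (p * (2 * 2 ^ p) + p * β₁ + p * β₁ / α₂ + p * μ₁) * energyLp p sol t := by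
  obtain ⟨I, hI⟩ : ∃ a, a = ∫ x in (0:ℝ)..1, (|sol.ut t x| ^ p + |sol.ux t x| ^ p) := ⟨_, rfl⟩
  have hW := sol.W_le_integral hp.le ht
  have hI0 := sol.integral_nonneg p t
  rw [energyLp, sol.normPow_eq ht]
  rw [← hI] at hW hI0 ⊢
  obtain ⟨e₀, he₀⟩ : ∃ a, a = 1 / p * I := ⟨_, rfl⟩
  obtain ⟨e₁, he₁⟩ : ∃ a, a = 1 / (p * β₁) * |sol.η₁ t| ^ p := ⟨_, rfl⟩
  obtain ⟨e₂, he₂⟩ : ∃ a, a = α₂ / (p * β₁) * |sol.η₂ t| ^ p := ⟨_, rfl⟩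
  obtain ⟨e₃, he₃⟩ : ∃ a, a = 1 / (p * μ₁) * |sol.ζ₁ t| ^ p := ⟨_, rfl⟩
  have hW' : sol.toFirstOrderSystem.W p t ≤ p * (2 * 2 ^ p) * e₀ :=
    hW.trans (le_of_eq (by rw [he₀]; field_simp))
  have hη₁ : |sol.η₁ t| ^ p = p * β₁ * e₁ := by rw [he₁]; field_simp
  have hη₂ : |sol.η₂ t| ^ p = p * β₁ / α₂ * e₂ := by rw [he₂]; field_simp
  have hζ₁ : |sol.ζ₁ t| ^ p = p * μ₁ * e₃ := by rw [he₃]; field_simp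
  have h₀ : 0 ≤ e₀ := by rw [he₀]; positivity
  have h₁ : 0 ≤ e₁ := by rw [he₁]; positivity
  have h₂ : 0 ≤ e₂ := by rw [he₂]; positivity
  have h₃ : 0 ≤ e₃ := by rw [he₃]; positivity
  rw [← he₀, ← he₁, ← he₂, ← he₃, hη₁, hη₂, hζ₁]
  have k₀ : 0 ≤ p * (2 * 2 ^ p) := by positivity
  have k₁ : 0 ≤ p * β₁ := by positivity
  have k₂ : 0 ≤ p * β₁ / α₂ := by positivity
  have k₃ : 0 ≤ p * μ₁ := by positivity
  simp only [add_mul, mul_add] at hW' ⊢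
  linarith [mul_nonneg k₀ h₁, mul_nonneg k₀ h₂, mul_nonneg k₀ h₃, mul_nonneg k₁ h₀,
    mul_nonneg k₁ h₂, mul_nonneg k₁ h₃, mul_nonneg k₂ h₀, mul_nonneg k₂ h₁,
    mul_nonneg k₂ h₃, mul_nonneg k₃ h₀, mul_nonneg k₃ h₁, mul_nonneg k₃ h₂]

end ClassicalSolutionS

/-- Exponential decay in the `L^p` setting, `2 < p < ∞`, for system (S) with `a ≡ 1`. -/
theorem exponential_stability_S_Lp (p : ℝ) (hp : 2 < p) (q : ℝ → ℝ)
    (c d q_min q_max α₁ α₂ β₁ γ₁ μ₁ : ℝ)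
    (hA2 : AssumptionA2 q c d q_min q_max)
    (hα₁ : 0 < α₁) (hα₂ : 0 < α₂) (hβ₁ : 0 < β₁) (hγ₁ : 0 < γ₁) (hμ₁ : 0 < μ₁) :
    ∃ M > (0:ℝ), ∃ ν > (0:ℝ),
      ∀ sol : ClassicalSolutionS (fun _ => 1) q α₁ α₂ β₁ γ₁ μ₁, ∀ t ∈ Ici (0:ℝ),
        energyLp p sol t ≤ M * Real.exp (-ν * t) * energyLp p sol 0 ∧
        ∀ x ∈ Icc (0:ℝ) 1,
          |sol.u t x - (sol.u 0 1 - sol.η₂ 0)| ^ p ≤ M * energyLp p sol 0 * Real.exp (-ν * t) := by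
  have hp0 : 0 < p := by linarith
  obtain ⟨l⟩ := nonempty_localizer hA2
  obtain ⟨C, hC, ν, hν, H⟩ := FirstOrderSystem.exists_normPow_decay l hp.le hα₁ hα₂ hβ₁ hγ₁ hμ₁
  obtain ⟨A, hA⟩ : ∃ a, a = 1 / p * (2 * 2 ^ p) + 1 / (p * β₁) + α₂ / (p * β₁) + 1 / (p * μ₁) :=
    ⟨_, rfl⟩
  obtain ⟨B, hB⟩ : ∃ b, b = p * (2 * 2 ^ p) + p * β₁ + p * β₁ / α₂ + p * μ₁ := ⟨_, rfl⟩
  have hA0 : 0 < A := by rw [hA]; positivity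
  have hB0 : 0 < B := by rw [hB]; positivity
  refine ⟨A * C * B + C * B + 1, by positivity, ν, hν, fun sol t ht => ?_⟩
  rw [mem_Ici] at ht
  obtain ⟨h1, h2⟩ := H sol.toFirstOrderSystem t ht
  have e1 := sol.energyLp_le_normPow hp0 hα₂ hβ₁ hμ₁ ht
  have e2 := sol.normPow_le_energyLp hp0 hα₂ hβ₁ hμ₁ le_rfl
  rw [← hA] at e1
  rw [← hB] at e2
  have hE : 0 ≤ energyLp p sol 0 := by
    have := sol.integral_nonneg p 0
    rw [energyLp]
    positivity
  obtain ⟨G, hG⟩ : ∃ g, g = energyLp p sol 0 * Real.exp (-ν * t) := ⟨_, rfl⟩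
  have hG0 : 0 ≤ G := by rw [hG]; positivity
  have h0 : C * sol.toFirstOrderSystem.normPow p 0 * Real.exp (-ν * t) ≤ C * B * G := by
    calc _ ≤ C * (B * energyLp p sol 0) * Real.exp (-ν * t) := by gcongr
      _ = _ := by rw [hG]; ring
  have p1 : 0 ≤ A * C * B * G := by positivity
  have p2 : 0 ≤ C * B * G := by positivity
  constructor
  · have e3 := mul_le_mul_of_nonneg_left (h1.trans h0) hA0.le
    rw [mul_assoc, mul_comm (Real.exp _), ← hG]
    linarith
  · intro x hx
    have h3 := h2 x hx
    change |stripExtend sol.displacement t x| ^ p ≤ _ at h3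
    rw [stripExtend_of_mem ht hx, ClassicalSolutionS.displacement] at h3
    rw [mul_assoc, ← hG]
    linarith
end

section
/- Let a : [0,1] → ℝ be Lipschitz with a(x) ≥ a_min > 0 for all x, and let L > 0 be such that |a'(x)| ≤ L·a(x) for a.e. x ∈ [0,1] (where a' denotes the a.e. derivative of a). Define g : [0,1] → ℝ by g(x) = a(x)·(e^{Lx} − 1)/(a_min·L). Then g is Lipschitz and its a.e. derivative satisfies g'(x) ≥ a(x)/a_min ≥ 1 for a.e. x ∈ [0,1]. -/
open Set MeasureTheory

/-- The product of two bounded real-valued Lipschitz functions on a set is Lipschitz. -/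
theorem LipschitzOnWith.mul_of_abs_le {α : Type*} [PseudoMetricSpace α] {s : Set α} {f g : α → ℝ}
    {Kf Kg A B : NNReal} (hf : LipschitzOnWith Kf f s) (hg : LipschitzOnWith Kg g s)
    (hfA : ∀ x ∈ s, |f x| ≤ A) (hgB : ∀ x ∈ s, |g x| ≤ B) :
    LipschitzOnWith (A * Kg + B * Kf) (fun x => f x * g x) s := by
  refine LipschitzOnWith.of_dist_le_mul fun x hx y hy => ?_
  have hf' := hf.dist_le_mul x hx y hy
  have hg' := hg.dist_le_mul x hx y hy
  rw [Real.dist_eq] at hf' hg' ⊢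
  calc |f x * g x - f y * g y| = |f x * (g x - g y) + g y * (f x - f y)| := by ring_nf
    _ ≤ |f x| * |g x - g y| + |g y| * |f x - f y| := by
      simpa only [abs_mul] using abs_add_le (f x * (g x - g y)) (g y * (f x - f y))
    _ ≤ A * (Kg * dist x y) + B * (Kf * dist x y) := by
      gcongr
      exacts [hfA x hx, hgB y hy]
    _ = ((A * Kg + B * Kf : NNReal) : ℝ) * dist x y := by push_cast; ring

/-- On a compact set, the product of two real-valued Lipschitz functions is Lipschitz. -/
theorem IsCompact.exists_lipschitzOnWith_mul {α : Type*} [PseudoMetricSpace α] {s : Set α}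
    (hs : IsCompact s) {f g : α → ℝ} {Kf Kg : NNReal} (hf : LipschitzOnWith Kf f s)
    (hg : LipschitzOnWith Kg g s) : ∃ K : NNReal, LipschitzOnWith K (fun x => f x * g x) s := by
  obtain ⟨A, hA⟩ := hs.exists_bound_of_continuousOn hf.continuousOn
  obtain ⟨B, hB⟩ := hs.exists_bound_of_continuousOn hg.continuousOn
  exact ⟨_, hf.mul_of_abs_le hg (fun x hx => (hA x hx).trans (Real.le_coe_toNNReal A))
    (fun x hx => (hB x hx).trans (Real.le_coe_toNNReal B))⟩

/-- For `a` Lipschitz, bounded below by `a_min > 0`, with a.e. derivative `a'` satisfying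
`|a'(x)| ≤ L a(x)` a.e., the function `g(x) = a(x)(e^{Lx}-1)/(a_min L)` is Lipschitz on `[0,1]`
and its a.e. derivative satisfies `g'(x) ≥ a(x)/a_min ≥ 1` a.e. on `[0,1]`. -/
theorem multiplier_weight_property (a a' : ℝ → ℝ) (a_min L : ℝ)
    (ha_lip : ∃ K : NNReal, LipschitzOnWith K a (Icc (0:ℝ) 1))
    (ha_min : 0 < a_min) (ha : ∀ x ∈ Icc (0:ℝ) 1, a_min ≤ a x) (hL : 0 < L)
    (ha' : ∀ᵐ x ∂(volume.restrict (Icc (0:ℝ) 1)), HasDerivAt a (a' x) x)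
    (ha'L : ∀ᵐ x ∂(volume.restrict (Icc (0:ℝ) 1)), |a' x| ≤ L * a x) :
    (∃ K : NNReal,
      LipschitzOnWith K (fun x => a x * (Real.exp (L * x) - 1) / (a_min * L)) (Icc (0:ℝ) 1)) ∧
    ∀ᵐ x ∂(volume.restrict (Icc (0:ℝ) 1)),
      HasDerivAt (fun y => a y * (Real.exp (L * y) - 1) / (a_min * L))
        (a' x * (Real.exp (L * x) - 1) / (a_min * L)
          + a x * (L * Real.exp (L * x)) / (a_min * L)) x ∧
      a x / a_min ≤ a' x * (Real.exp (L * x) - 1) / (a_min * L)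
          + a x * (L * Real.exp (L * x)) / (a_min * L) ∧
      1 ≤ a x / a_min := by
  constructor
  · obtain ⟨Ka, hKa⟩ := ha_lip
    have hsmooth : ContDiff ℝ 1 fun x : ℝ => (Real.exp (L * x) - 1) / (a_min * L) := by fun_prop
    obtain ⟨Kw, hKw⟩ := hsmooth.contDiffOn.exists_lipschitzOnWith one_ne_zero
      (convex_Icc (0 : ℝ) 1) isCompact_Icc
    simpa only [mul_div_assoc] using isCompact_Icc.exists_lipschitzOnWith_mul hKa hKw
  · filter_upwards [ha', ha'L, ae_restrict_mem measurableSet_Icc] with x hx hxL hmem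
    have hexp : HasDerivAt (fun y => Real.exp (L * y) - 1) (L * Real.exp (L * x)) x := by
      simpa [mul_comm] using (((hasDerivAt_id x).const_mul L).exp).sub_const 1
    refine ⟨?_, ?_, (one_le_div ha_min).2 (ha x hmem)⟩
    · rw [← add_div]
      exact (hx.mul hexp).div_const _
    · have hexp_ge : 0 ≤ Real.exp (L * x) - 1 :=
        sub_nonneg.2 (Real.one_le_exp (mul_nonneg hL.le hmem.1))
      have key : a x * L ≤ a' x * (Real.exp (L * x) - 1) + a x * (L * Real.exp (L * x)) := by
        nlinarith [mul_le_mul_of_nonneg_right (neg_le_of_abs_le hxL) hexp_ge]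
      rw [← add_div, ← mul_div_mul_right (a x) a_min hL.ne']
      gcongr
end
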